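/- Let A be a nowhere scattered C*-algebra with k-comparison. Assume that the family of separable sub-C*-algebras of A having a surjective rank map is σ-complete and cofinal. Then for every [a] ∈ Cu(A) there exists y ∈ Cu(A) with 2(k+1)·y ≤ (k+1)·[a] ≤ 4(k+1)³·y; in particular Div_{2(k+1)}((k+1)·[a]) ≤ 4(k+1)³. -/

import Mathlib

/-!
Common definitions: abstract Cuntz semigroups, divisibility, and C*-algebra notions
(nowhere scatteredness, σ-unitality, etc.) used to formalize the statements.
-/

open scoped MultiplierAlgebra ENNReal
open Filter Topology

noncomputable section

universe uu vv

/-- The (sequential) way-below relation `x ≪ y` (compact containment) in a partially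
ordered set: whenever an increasing sequence has a supremum lying above `y`, some term
of the sequence already lies above `x`. -/
def WayBelow {S : Type*} [PartialOrder S] (x y : S) : Prop :=
  ∀ f : ℕ → S, Monotone f → ∀ s : S, IsLUB (Set.range f) s → y ≤ s → ∃ n, x ≤ f n

/-- An abstract Cuntz semigroup (`Cu`-semigroup): a positively ordered abelian monoid in
which every increasing sequence has a supremum, every element is the supremum of a
`≪`-increasing sequence, addition preserves `≪`, and which satisfies the standard
axioms (O5) (almost algebraic order) and (O6) (almost Riesz decomposition), as well as
the existence of infima with idempotents `∞y = sup_n n•y` (all of these hold in the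
Cuntz semigroup of any C*-algebra). -/
class CuSemigroup (S : Type*) extends AddCommMonoid S, PartialOrder S where
  add_le_add' : ∀ a b : S, a ≤ b → ∀ c : S, c + a ≤ c + b
  zero_le' : ∀ x : S, 0 ≤ x
  exists_isLUB : ∀ f : ℕ → S, Monotone f → ∃ s : S, IsLUB (Set.range f) s
  exists_waybelow_seq : ∀ x : S, ∃ f : ℕ → S, Monotone f ∧
    (∀ n, WayBelow (f n) (f (n + 1))) ∧ IsLUB (Set.range f) x
  waybelow_add : ∀ {x y z w : S}, WayBelow x y → WayBelow z w → WayBelow (x + z) (y + w)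
  /-- axiom (O5) -/
  almost_algebraic : ∀ x' x y' y z : S, WayBelow x' x → WayBelow y' y → x + y ≤ z →
    ∃ c : S, y' ≤ c ∧ x' + c ≤ z ∧ z ≤ x + c
  /-- axiom (O6) -/
  almost_riesz : ∀ x' x y z : S, WayBelow x' x → x ≤ y + z →
    ∃ v w : S, v ≤ x ∧ v ≤ y ∧ w ≤ x ∧ w ≤ z ∧ x' ≤ v + w
  /-- `infty y = ∞·y = sup_n n•y` -/
  infty : S → S
  isLUB_infty : ∀ y : S, IsLUB (Set.range fun n : ℕ => n • y) (infty y)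
  /-- the infimum `x ⊓ ∞y`, which exists in the Cuntz semigroup of any C*-algebra -/
  meetInfty : S → S → S
  isGLB_meetInfty : ∀ x y : S, IsGLB {x, infty y} (meetInfty x y)

namespace CuDiv

variable {S : Type*} [CuSemigroup S]

/-- `x` is weakly `(m, n)`-divisible. -/
def IsWeaklyDivisible (m n : ℕ) (x : S) : Prop :=
  ∀ x' : S, WayBelow x' x → ∃ y : Fin n → S, x' ≤ ∑ j, y j ∧ ∀ j, m • y j ≤ x

/-- `x` is `(m, n)`-divisible. -/
def IsDivisible (m n : ℕ) (x : S) : Prop :=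
  ∀ x' : S, WayBelow x' x → ∃ y : S, x' ≤ n • y ∧ m • y ≤ x

/-- `x` is weakly `(m, ω)`-divisible. -/
def IsWeaklyOmegaDivisible (m : ℕ) (x : S) : Prop :=
  ∀ x' : S, WayBelow x' x → ∃ (n : ℕ) (y : Fin n → S), x' ≤ ∑ j, y j ∧ ∀ j, m • y j ≤ x

/-- `x` is `(m, ω)`-divisible. -/
def IsOmegaDivisible (m : ℕ) (x : S) : Prop :=
  ∀ x' : S, WayBelow x' x → ∃ (y : S) (n : ℕ), x' ≤ n • y ∧ m • y ≤ x

/-- `wdiv m x` is the least positive integer `n` such that `x` is weakly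
`(m,n)`-divisible, and `∞` if there is no such `n`. -/
def wdiv (m : ℕ) (x : S) : ℕ∞ :=
  sInf {N : ℕ∞ | ∃ n : ℕ, 1 ≤ n ∧ N = n ∧ IsWeaklyDivisible m n x}

/-- `Div m x` is the least positive integer `n` such that `x` is `(m,n)`-divisible,
and `∞` if there is no such `n`. -/
def Div (m : ℕ) (x : S) : ℕ∞ :=
  sInf {N : ℕ∞ | ∃ n : ℕ, 1 ≤ n ∧ N = n ∧ IsDivisible m n x}

/-- An element `x` is strongly soft if for every `x' ≪ x` there is `t` with
`x' + t ≤ x ≤ ∞t`. -/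
def StronglySoft (x : S) : Prop :=
  ∀ x' : S, WayBelow x' x → ∃ t : S, x' + t ≤ x ∧ x ≤ CuSemigroup.infty t

/-- The Cuntz semigroup characterization of the Global Glimm Property: every element is
`(m, ω)`-divisible for every `m`. -/
def GlobalGlimm (S : Type*) [CuSemigroup S] : Prop :=
  ∀ (m : ℕ) (x : S), IsOmegaDivisible m x

/-- `Cu(A)` is left-soft separative. -/
def LeftSoftSeparative (S : Type*) [CuSemigroup S] : Prop :=
  ∀ x y t : S, StronglySoft x → WayBelow (x + t) (y + t) →
    WayBelow t (CuSemigroup.infty y) → WayBelow t (CuSemigroup.infty x) → WayBelow x y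

/-- `Cu(A)` is weakly cancellative. -/
def WeaklyCancellative (S : Type*) [CuSemigroup S] : Prop :=
  ∀ x y z : S, WayBelow (x + z) (y + z) → WayBelow x y

/-- `Cu(A)` has covering dimension zero. -/
def CoveringDimZero (S : Type*) [CuSemigroup S] : Prop :=
  ∀ x' x y₁ y₂ : S, WayBelow x' x → WayBelow x (y₁ + y₂) →
    ∃ z₁ z₂ : S, z₁ ≤ y₁ ∧ z₂ ≤ y₂ ∧ x' ≤ z₁ + z₂ ∧ z₁ + z₂ ≤ x

end CuDiv

/-- A functional on a Cuntz semigroup: an additive, order preserving map to `ℝ≥0∞`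
preserving suprema of increasing sequences.  (By Elliott–Robert–Santiago, the
functionals on `Cu(A)` are exactly those induced by the lower semicontinuous
2-quasitraces on `A ⊗ K`.) -/
structure CuFunctional (S : Type*) [CuSemigroup S] where
  toFun : S → ℝ≥0∞
  map_zero' : toFun 0 = 0
  map_add' : ∀ x y : S, toFun (x + y) = toFun x + toFun y
  mono' : ∀ x y : S, x ≤ y → toFun x ≤ toFun y
  sup' : ∀ f : ℕ → S, Monotone f → ∀ s : S, IsLUB (Set.range f) s →
    toFun s = ⨆ n, toFun (f n)

instance {S : Type*} [CuSemigroup S] : CoeFun (CuFunctional S) fun _ => S → ℝ≥0∞ :=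
  ⟨CuFunctional.toFun⟩

namespace CuDiv

variable {S : Type*} [CuSemigroup S]

/-- `x <ₛ y` : there is `γ < 1` with `λ(x) ≤ γ·λ(y)` for every functional `λ`. -/
def FunctionalLT (x y : S) : Prop :=
  ∃ γ : ℝ≥0∞, γ < 1 ∧ ∀ lam : CuFunctional S, lam x ≤ γ * lam y

/-- `A` has `k`-comparison (stated on `Cu(A)`). -/
def KComparison (S : Type*) [CuSemigroup S] (k : ℕ) : Prop :=
  ∀ (x : S) (b : Fin (k + 1) → S), (∀ i, FunctionalLT x (b i)) → x ≤ ∑ i, b i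

/-- `A` has strict comparison (stated on `Cu(A)`, via functionals, which correspond to
the lower semicontinuous 2-quasitraces). -/
def StrictComparison (S : Type*) [CuSemigroup S] : Prop :=
  ∀ x y : S, FunctionalLT x y → x ≤ y

/-- The natural topology on the cone `F(Cu(A))` of functionals. -/
def functionalTopology (S : Type*) [CuSemigroup S] : TopologicalSpace (CuFunctional S) :=
  TopologicalSpace.generateFrom
    ({U | ∃ (x : S) (r : ℝ≥0∞), U = {lam : CuFunctional S | r < lam x}} ∪
      {U | ∃ (x' x : S) (r : ℝ≥0∞), WayBelow x' x ∧ U = {lam : CuFunctional S | lam x' < r}})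

/-- A lower semicontinuous affine function on the cone of functionals of `Cu(A)`,
i.e. an element of `L(F(Cu(A)))`. -/
def IsLscAffine (F : CuFunctional S → ℝ≥0∞) : Prop :=
  (letI := functionalTopology S; LowerSemicontinuous F) ∧
    (∀ lam mu nu : CuFunctional S, (∀ x, nu x = lam x + mu x) → F nu = F lam + F mu) ∧
    (∀ (r : ℝ≥0∞) (lam nu : CuFunctional S), (∀ x, nu x = r * lam x) → F nu = r * F lam)

/-- The rank map of `Cu(A)` is surjective: every lower semicontinuous affine function on
the cone of functionals is realized as the rank function `λ ↦ λ(x)` of an element. -/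
def SurjectiveRankMap (S : Type*) [CuSemigroup S] : Prop :=
  ∀ F : CuFunctional S → ℝ≥0∞, IsLscAffine F → ∃ y : S, ∀ lam : CuFunctional S, lam y = F lam

end CuDiv

/-! ### C*-algebra notions -/

section CStar

variable {B : Type*} [NonUnitalCStarAlgebra B]

/-- Positivity in a C*-algebra: `a` is positive iff it is of the form `star b * b`. -/
def CStarNonneg (a : B) : Prop := ∃ b : B, a = star b * b

/-- Cuntz subequivalence `a ≼ b` : `a = lim_n rₙ b rₙ*`. -/
def CuntzBelow (a b : B) : Prop :=
  ∃ r : ℕ → B, Tendsto (fun n => r n * b * star (r n)) atTop (𝓝 a)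

/-- Cuntz equivalence. -/
def CuntzEquiv (a b : B) : Prop := CuntzBelow a b ∧ CuntzBelow b a

/-- `A` is σ-unital: it has a countable (norm-bounded, positive) approximate unit. -/
def SigmaUnital (A : Type*) [NonUnitalCStarAlgebra A] : Prop :=
  ∃ e : ℕ → A, (∀ n, CStarNonneg (e n) ∧ ‖e n‖ ≤ 1) ∧
    ∀ a : A, Tendsto (fun n => e n * a) atTop (𝓝 a) ∧ Tendsto (fun n => a * e n) atTop (𝓝 a)

end CStar

/-- A closed two-sided (automatically star-closed) ideal of a C*-algebra. -/
structure ClosedTwoSidedIdealC (A : Type*) [NonUnitalCStarAlgebra A] where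
  carrier : NonUnitalStarSubalgebra ℂ A
  isClosed : IsClosed (carrier : Set A)
  mul_mem_left : ∀ a : A, ∀ x ∈ carrier, a * x ∈ carrier
  mul_mem_right : ∀ a : A, ∀ x ∈ carrier, x * a ∈ carrier

section Reps

variable {A : Type*} [NonUnitalCStarAlgebra A]
variable {H : Type*} [NormedAddCommGroup H] [InnerProductSpace ℂ H] [CompleteSpace H]

/-- A (topologically) irreducible representation of `A` on a Hilbert space `H`. -/
def IsIrreducibleRep (π : A →⋆ₙₐ[ℂ] (H →L[ℂ] H)) : Prop :=
  (∃ a : A, π a ≠ 0) ∧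
    ∀ K : Submodule ℂ H, IsClosed (K : Set H) → (∀ a : A, ∀ v ∈ K, π a v ∈ K) →
      K = ⊥ ∨ K = ⊤

end Reps

/-- `A` has a nonzero elementary ideal-quotient `J/I`, expressed via a surjection of a
closed two-sided ideal `J` of `A` onto the algebra of compact operators on a Hilbert
space (the kernel `I` of such a `*`-homomorphism is automatically a closed two-sided
ideal of `A`, and conversely any nonzero elementary ideal-quotient arises this way). -/
def HasNonzeroElementaryIdealQuotient (A : Type*) [NonUnitalCStarAlgebra A] : Prop :=
  ∃ (J : ClosedTwoSidedIdealC A) (H : Type) (_ : NormedAddCommGroup H)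
    (_ : InnerProductSpace ℂ H) (_ : CompleteSpace H)
    (ψ : J.carrier →⋆ₙₐ[ℂ] (H →L[ℂ] H)),
      Set.range ψ = {T : H →L[ℂ] H | IsCompactOperator ⇑T} ∧ ∃ x, ψ x ≠ 0

/-- A C*-algebra is nowhere scattered if no ideal-quotient of it is nonzero and
elementary. -/
def NowhereScattered (A : Type*) [NonUnitalCStarAlgebra A] : Prop :=
  ¬ HasNonzeroElementaryIdealQuotient A

/-- A C*-algebra is elementary if it is isomorphic to the algebra of compact operators
on some Hilbert space. -/
def IsElementaryCStar (A : Type*) [NonUnitalCStarAlgebra A] : Prop :=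
  ∃ (H : Type) (_ : NormedAddCommGroup H) (_ : InnerProductSpace ℂ H) (_ : CompleteSpace H)
    (ψ : A →⋆ₙₐ[ℂ] (H →L[ℂ] H)),
      Function.Injective ψ ∧ Set.range ψ = {T : H →L[ℂ] H | IsCompactOperator ⇑T}

/-- A C*-algebra is simple if it is nonzero and has no nontrivial closed two-sided
ideals. -/
def IsSimpleCStar (A : Type*) [NonUnitalCStarAlgebra A] : Prop :=
  (∃ a : A, a ≠ 0) ∧
    ∀ J : ClosedTwoSidedIdealC A, (J.carrier : Set A) = {0} ∨ (J.carrier : Set A) = Set.univ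

/-- Real rank zero: the invertible self-adjoint elements are dense in the self-adjoint
part of the minimal unitization. -/
def RealRankZero (A : Type*) [NonUnitalCStarAlgebra A] : Prop :=
  ∀ x : Unitization ℂ A, IsSelfAdjoint x →
    x ∈ closure {y : Unitization ℂ A | IsSelfAdjoint y ∧ IsUnit y}

/-- Stable rank one: the invertible elements are dense in the minimal unitization. -/
def StableRankOne (A : Type*) [NonUnitalCStarAlgebra A] : Prop :=
  ∀ x : Unitization ℂ A, x ∈ closure {y : Unitization ℂ A | IsUnit y}

section CP

variable {A B : Type*} [NonUnitalCStarAlgebra A] [NonUnitalCStarAlgebra B]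

/-- A linear map between C*-algebras is completely positive if all of its matrix
amplifications preserve positivity. -/
def IsCompletelyPositive (φ : A →ₗ[ℂ] B) : Prop :=
  ∀ (n : ℕ) (a : Matrix (Fin n) (Fin n) A), (∃ b : Matrix (Fin n) (Fin n) A, a = star b * b) →
    ∃ c : Matrix (Fin n) (Fin n) B, a.map ⇑φ = star c * c

/-- A completely positive contractive (c.p.c.) map. -/
def IsCPC (φ : A →ₗ[ℂ] B) : Prop :=
  IsCompletelyPositive φ ∧ ∀ a : A, ‖φ a‖ ≤ ‖a‖

/-- A map between C*-algebras has order zero if it preserves orthogonality of positive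
elements. -/
def IsOrderZero (φ : A →ₗ[ℂ] B) : Prop :=
  ∀ a b : A, CStarNonneg a → CStarNonneg b → a * b = 0 → φ a * φ b = 0

end CP

/-- `A` has nuclear dimension at most `k`: there are c.p.c. approximations of the
identity through finite dimensional C*-algebras in which the downwards maps are sums of
`k+1` c.p.c. order zero maps. -/
def NuclearDimLE (A : Type*) [NonUnitalCStarAlgebra A] (k : ℕ) : Prop :=
  ∀ (F : Finset A) (ε : ℝ), 0 < ε →
    ∃ (Fd : Type) (_ : NonUnitalCStarAlgebra Fd) (_ : FiniteDimensional ℂ Fd)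
      (ψ : A →ₗ[ℂ] Fd) (φ : Fin (k + 1) → (Fd →ₗ[ℂ] A)),
        IsCPC ψ ∧ (∀ i, IsCPC (φ i) ∧ IsOrderZero (φ i)) ∧
        ∀ a ∈ F, ‖(∑ i, φ i (ψ a)) - a‖ ≤ ε

section Prim

variable (A : Type*) [NonUnitalCStarAlgebra A]

/-- A primitive ideal: the kernel of an irreducible representation. -/
def IsPrimitiveIdeal {A : Type*} [NonUnitalCStarAlgebra A] (J : ClosedTwoSidedIdealC A) : Prop :=
  ∃ (H : Type) (_ : NormedAddCommGroup H) (_ : InnerProductSpace ℂ H) (_ : CompleteSpace H)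
    (π : A →⋆ₙₐ[ℂ] (H →L[ℂ] H)),
      IsIrreducibleRep π ∧ ∀ a : A, a ∈ J.carrier ↔ π a = 0

/-- The primitive ideal space of `A`. -/
def PrimIdealSpace := {J : ClosedTwoSidedIdealC A // IsPrimitiveIdeal J}

/-- The hull-kernel (Jacobson) topology on the primitive ideal space. -/
instance : TopologicalSpace (PrimIdealSpace A) :=
  TopologicalSpace.generateFrom {U | ∃ a : A, U = {P : PrimIdealSpace A | a ∉ P.1.carrier}}

/-- `A` has topological dimension zero: the primitive ideal space has a basis of
compact open sets. -/
def TopDimZero : Prop :=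
  ∃ 𝒷 : Set (Set (PrimIdealSpace A)), TopologicalSpace.IsTopologicalBasis 𝒷 ∧
    ∀ U ∈ 𝒷, IsCompact U ∧ IsOpen U

end Prim

section Proj

variable {B : Type*} [NonUnitalCStarAlgebra B]

/-- A projection in a C*-algebra. -/
def IsProjectionElem (p : B) : Prop := IsSelfAdjoint p ∧ p * p = p

/-- `B` contains an infinite projection: a projection which is Murray-von Neumann
equivalent to a proper subprojection of itself. -/
def HasInfiniteProjection (B : Type*) [NonUnitalCStarAlgebra B] : Prop :=
  ∃ p v : B, IsProjectionElem p ∧ star v * v = p ∧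
    p * (v * star v) = v * star v ∧ v * star v ≠ p

end Proj

/-! ### The Cuntz semigroup of a C*-algebra -/

/-- Padding a matrix by one extra row and column of zeros. -/
def matPad {A : Type*} [Zero A] {n : ℕ} (a : Matrix (Fin n) (Fin n) A) :
    Matrix (Fin (n + 1)) (Fin (n + 1)) A :=
  Matrix.of fun i j =>
    if h : (i : ℕ) < n ∧ (j : ℕ) < n then a ⟨i, h.1⟩ ⟨j, h.2⟩ else 0

/-- A witness that `S` is the Cuntz semigroup of the C*-algebra `A`: it provides a
stabilization `stab` of `A` (a model of `A ⊗ K`, described as the C*-completion of the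
union of the matrix algebras `Mₙ(A)`), together with the class map
`cls : (stab)₊ → S = Cu(A)` identifying `S` with the set of Cuntz equivalence classes of
positive elements of `A ⊗ K`, with order induced by Cuntz subequivalence, addition
induced by orthogonal (diagonal) addition, and with the compact containment relation
`≪` given by `x ≪ [a]` iff `x ≤ [(a - ε)₊]` for some `ε > 0`. -/
structure IsCuntzSemigroupOf (A : Type uu) [NonUnitalCStarAlgebra A]
    (S : Type vv) [CuSemigroup S] where
  stab : Type (max uu vv)
  [stabCStar : NonUnitalCStarAlgebra stab]
  matEmb : (n : ℕ) → (Matrix (Fin n) (Fin n) A →⋆ₙₐ[ℂ] stab)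
  matEmb_injective : ∀ n, Function.Injective (matEmb n)
  matEmb_compat : ∀ (n : ℕ) (a : Matrix (Fin n) (Fin n) A), matEmb (n + 1) (matPad a) = matEmb n a
  matEmb_dense : Dense (⋃ n, Set.range (matEmb n))
  cls : stab → S
  cls_zero : cls 0 = 0
  cls_surj : ∀ s : S, ∃ b : stab, CStarNonneg b ∧ cls b = s
  cls_le_iff : ∀ a b : stab, CStarNonneg a → CStarNonneg b → (cls a ≤ cls b ↔ CuntzBelow a b)
  cls_add_orth : ∀ a b : stab, CStarNonneg a → CStarNonneg b → a * b = 0 →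
    cls (a + b) = cls a + cls b
  exists_orth : ∀ a b : stab, CStarNonneg a → CStarNonneg b →
    ∃ a' b' : stab, CStarNonneg a' ∧ CStarNonneg b' ∧ a' * b' = 0 ∧
      cls a' = cls a ∧ cls b' = cls b
  waybelow_iff : ∀ (x : S) (a : stab), CStarNonneg a →
    (WayBelow x (cls a) ↔ ∃ ε : ℝ, 0 < ε ∧ x ≤ cls (cfcₙ (fun t : ℝ => max (t - ε) 0) a))

attribute [instance] IsCuntzSemigroupOf.stabCStar

/-- The Cuntz class `[a] ∈ Cu(A)` of an element `a` of `A` itself (via the canonical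
embedding `A ≅ M₁(A) ⊆ A ⊗ K`). -/
def IsCuntzSemigroupOf.clsA {A : Type*} [NonUnitalCStarAlgebra A] {S : Type*} [CuSemigroup S]
    (h : IsCuntzSemigroupOf A S) (a : A) : S :=
  h.cls (h.matEmb 1 (Matrix.of fun _ _ => a))

/-- `B` has a surjective rank map (every lower semicontinuous affine function on the
cone of functionals on `Cu(B)` is realized as a rank function). -/
def HasSurjectiveRankMap (B : Type*) [NonUnitalCStarAlgebra B] : Prop :=
  ∀ (S : Type) (inst : CuSemigroup S), IsCuntzSemigroupOf B S → CuDiv.SurjectiveRankMap S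

/-- The family of separable sub-C*-algebras of `A` having a surjective rank map. -/
def sepSurjRankFamily (A : Type*) [NonUnitalCStarAlgebra A] :
    Set (NonUnitalStarSubalgebra ℂ A) :=
  {B | ∃ _h : IsClosed (B : Set A),
    TopologicalSpace.SeparableSpace B ∧ HasSurjectiveRankMap B}

/-- The family of separable sub-C*-algebras of `A` with a surjective rank map is
σ-complete (closed under countable increasing unions) and cofinal (every separable
sub-C*-algebra is contained in a member). -/
def SepSurjRankFamilySigmaCompleteCofinal (A : Type*) [NonUnitalCStarAlgebra A] : Prop :=
  (∀ Bseq : ℕ → NonUnitalStarSubalgebra ℂ A, Monotone Bseq →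
    (∀ n, Bseq n ∈ sepSurjRankFamily A) →
      (⨆ n, Bseq n).topologicalClosure ∈ sepSurjRankFamily A) ∧
  (∀ C : NonUnitalStarSubalgebra ℂ A, IsClosed (C : Set A) →
    TopologicalSpace.SeparableSpace C → ∃ B ∈ sepSurjRankFamily A, C ≤ B)

end

namespace CuntzComparison

section Basic

variable {D : Type*} [NonUnitalCStarAlgebra D]

theorem cuntzBelow_iff {a b : D} :
    CuntzBelow a b ↔ ∀ ε : ℝ, 0 < ε → ∃ r : D, ‖a - r * b * star r‖ < ε := by
  constructor
  · rintro ⟨r, hr⟩ ε hε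
    obtain ⟨n, hn⟩ := ((Metric.tendsto_nhds.1 hr) ε hε).exists
    exact ⟨r n, by rwa [dist_comm, dist_eq_norm] at hn⟩
  · intro h
    choose r hr using fun n : ℕ => h (1 / ((n : ℝ) + 1)) Nat.one_div_pos_of_nat
    refine ⟨r, tendsto_iff_norm_sub_tendsto_zero.2 ?_⟩
    refine squeeze_zero (fun _ => norm_nonneg _) (fun n => ?_)
      tendsto_one_div_add_atTop_nhds_zero_nat
    rw [norm_sub_rev]
    exact (hr n).le

theorem cuntzBelow_conjugate (r b : D) : CuntzBelow (r * b * star r) b :=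
  ⟨fun _ => r, tendsto_const_nhds⟩

theorem norm_conjugate_le (r x : D) : ‖r * x * star r‖ ≤ ‖r‖ ^ 2 * ‖x‖ := by
  calc ‖r * x * star r‖ ≤ ‖r * x‖ * ‖star r‖ := norm_mul_le _ _
    _ ≤ ‖r‖ * ‖x‖ * ‖star r‖ := by gcongr; exact norm_mul_le _ _
    _ = ‖r‖ ^ 2 * ‖x‖ := by rw [norm_star]; ring

theorem exists_pos_mul_lt_of_nonneg {K : ℝ} (hK : 0 ≤ K) {ε : ℝ} (hε : 0 < ε) :
    ∃ δ : ℝ, 0 < δ ∧ K * δ < ε := by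
  refine ⟨ε / (K + 1), by positivity, ?_⟩
  rw [mul_div_assoc', div_lt_iff₀ (by positivity)]
  nlinarith

theorem _root_.CuntzBelow.trans {a b c : D} (hab : CuntzBelow a b) (hbc : CuntzBelow b c) :
    CuntzBelow a c := by
  rw [cuntzBelow_iff] at *
  intro ε hε
  obtain ⟨r, hr⟩ := hab (ε / 2) (by positivity)
  obtain ⟨δ, hδ, hδ'⟩ := exists_pos_mul_lt_of_nonneg (sq_nonneg ‖r‖) (half_pos hε)
  obtain ⟨s, hs⟩ := hbc δ hδ
  refine ⟨r * s, ?_⟩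
  have e : a - r * s * c * star (r * s) =
      (a - r * b * star r) + r * (b - s * c * star s) * star r := by
    simp only [star_mul, mul_sub, sub_mul, mul_assoc]; abel
  have h1 := norm_conjugate_le r (b - s * c * star s)
  have h2 : ‖r‖ ^ 2 * ‖b - s * c * star s‖ ≤ ‖r‖ ^ 2 * δ := by gcongr
  rw [e]
  exact (norm_add_le _ _).trans_lt (by linarith)

/-- The relation `a ≼ b` is closed in `a`. -/
theorem cuntzBelow_of_forall_near {a b : D}
    (h : ∀ ε : ℝ, 0 < ε → ∃ a' : D, ‖a - a'‖ ≤ ε ∧ CuntzBelow a' b) : CuntzBelow a b := by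
  rw [cuntzBelow_iff]
  intro ε hε
  obtain ⟨a', h1, h2⟩ := h (ε / 2) (by positivity)
  obtain ⟨r, hr⟩ := cuntzBelow_iff.1 h2 (ε / 2) (by positivity)
  refine ⟨r, ?_⟩
  have e : a - r * b * star r = (a - a') + (a' - r * b * star r) := by abel
  rw [e]
  exact (norm_add_le _ _).trans_lt (by linarith)

/-- The closed left ideal generated by `y`. -/
def leftIdeal (y : D) : Set D := {z | ∀ ε : ℝ, 0 < ε → ∃ x : D, ‖z - x * y‖ < ε}

theorem mul_mem_leftIdeal {y z : D} (w : D) (hz : z ∈ leftIdeal y) : w * z ∈ leftIdeal y := by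
  intro ε hε
  obtain ⟨δ, hδ, hδ'⟩ := exists_pos_mul_lt_of_nonneg (norm_nonneg w) hε
  obtain ⟨x, hx⟩ := hz δ hδ
  refine ⟨w * x, ?_⟩
  rw [mul_assoc, ← mul_sub]
  calc ‖w * (z - x * y)‖ ≤ ‖w‖ * ‖z - x * y‖ := norm_mul_le _ _
    _ ≤ ‖w‖ * δ := by gcongr
    _ < ε := hδ'

theorem add_mem_leftIdeal {y z w : D} (hz : z ∈ leftIdeal y) (hw : w ∈ leftIdeal y) :
    z + w ∈ leftIdeal y := by
  intro ε hε
  obtain ⟨x, hx⟩ := hz (ε / 2) (by positivity)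
  obtain ⟨x', hx'⟩ := hw (ε / 2) (by positivity)
  refine ⟨x + x', ?_⟩
  have e : z + w - (x + x') * y = (z - x * y) + (w - x' * y) := by rw [add_mul]; abel
  rw [e]
  exact (norm_add_le _ _).trans_lt (by linarith)

theorem neg_mem_leftIdeal {y z : D} (hz : z ∈ leftIdeal y) : -z ∈ leftIdeal y := by
  intro ε hε
  obtain ⟨x, hx⟩ := hz ε hε
  refine ⟨-x, ?_⟩
  have e : -z - -x * y = -(z - x * y) := by rw [neg_mul]; abel
  rwa [e, norm_neg]

theorem sub_mem_leftIdeal {y z w : D} (hz : z ∈ leftIdeal y) (hw : w ∈ leftIdeal y) :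
    z - w ∈ leftIdeal y := by
  rw [sub_eq_add_neg]
  exact add_mem_leftIdeal hz (neg_mem_leftIdeal hw)

theorem _root_.CuntzBelow.smul_right {x y : D} (h : CuntzBelow x y) {c : ℝ} (hc : 0 < c) :
    CuntzBelow x (c • y) := by
  obtain ⟨r, hr⟩ := h
  refine ⟨fun n => (√c)⁻¹ • r n, ?_⟩
  convert hr using 2 with n
  have : (√c)⁻¹ * ((√c)⁻¹ * c) = 1 := by
    have := Real.sqrt_pos.2 hc
    nth_rewrite 3 [← Real.mul_self_sqrt hc.le]
    field_simp
  simp only [star_smul, star_trivial, smul_mul_assoc, mul_smul_comm, smul_smul]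
  rw [← mul_assoc] at this
  rw [show (√c)⁻¹ * (c * (√c)⁻¹) = 1 by rw [← this]; ring, one_smul]

theorem _root_.CuntzBelow.of_smul_right {x y : D} {c : ℝ} (hc : 0 < c) (h : CuntzBelow x (c • y)) :
    CuntzBelow x y := by
  have := h.smul_right (inv_pos.2 hc)
  rwa [smul_smul, inv_mul_cancel₀ hc.ne', one_smul] at this

end Basic

section Order

variable {D : Type*} [NonUnitalCStarAlgebra D] [PartialOrder D] [StarOrderedRing D]

theorem cStarNonneg_iff {a : D} : CStarNonneg a ↔ 0 ≤ a :=
  CStarAlgebra.nonneg_iff_eq_star_mul_self.symm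

theorem exists_sqrt {a : D} (ha : 0 ≤ a) : ∃ g : D, star g = g ∧ 0 ≤ g ∧ g * g = a :=
  ⟨CFC.sqrt a, (CFC.sqrt_nonneg a).isSelfAdjoint.star_eq, CFC.sqrt_nonneg a,
    CFC.sqrt_mul_sqrt_self a ha⟩

theorem nonneg_conjugate {b : D} (hb : 0 ≤ b) (r : D) : 0 ≤ r * b * star r :=
  star_right_conjugate_nonneg hb r

/-- A positive element has local approximate units in `D a`. -/
theorem exists_localUnit {a : D} (ha : 0 ≤ a) {ε : ℝ} (hε : 0 < ε) :
    ∃ k : D, star k = k ∧ k * a = a * k ∧ ‖a - k * a * a * (a * k)‖ ≤ ε ∧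
      ‖a - a * (k * a) - (a * k) * a + (a * k) * a * (k * a)‖ ≤ ε := by
  have hs : IsSelfAdjoint a := ha.isSelfAdjoint
  set f : ℝ → ℝ := fun t => t / (t ^ 2 + (ε / 2) ^ 2) with hf
  have hden : ∀ t : ℝ, 0 < t ^ 2 + (ε / 2) ^ 2 := fun t => by positivity
  have hfc : Continuous f := by
    refine continuous_id.div (by fun_prop) fun t => (hden t).ne'
  have hf0 : f 0 = 0 := by simp [hf]
  have hid : cfcₙ (fun t : ℝ => t) a = a := cfcₙ_id' ℝ a
  have hka : cfcₙ (fun t => f t * t) a = cfcₙ f a * a := by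
    rw [cfcₙ_mul _ _ _ hfc.continuousOn hf0 (by fun_prop) (by simp), hid]
  have hak : cfcₙ (fun t => t * f t) a = a * cfcₙ f a := by
    rw [cfcₙ_mul _ _ _ (by fun_prop) (by simp) hfc.continuousOn hf0, hid]
  have hbound : ∀ t : ℝ, |t| * (ε / 2) ^ 2 / (t ^ 2 + (ε / 2) ^ 2) ≤ ε / 2 := fun t => by
    rw [div_le_iff₀ (hden t)]
    nlinarith [sq_abs t, sq_nonneg (|t| - ε / 2), sq_nonneg t, abs_nonneg t]
  have hft : ∀ t : ℝ, f t * t = 1 - (ε / 2) ^ 2 / (t ^ 2 + (ε / 2) ^ 2) := fun t => by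
    have := (hden t).ne'
    simp only [hf]
    field_simp
    ring
  have hu : ∀ t : ℝ, 0 ≤ (ε / 2) ^ 2 / (t ^ 2 + (ε / 2) ^ 2) ∧
      (ε / 2) ^ 2 / (t ^ 2 + (ε / 2) ^ 2) ≤ 1 := fun t =>
    ⟨by positivity, by rw [div_le_one (hden t)]; nlinarith [sq_nonneg t]⟩
  refine ⟨cfcₙ f a, (cfcₙ_predicate f a).star_eq, ?_, ?_, ?_⟩
  · rw [← hka, ← hak]
    simp only [mul_comm]
  · have e : cfcₙ (fun t => t - f t * t * t * (t * f t)) a =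
        a - cfcₙ f a * a * a * (a * cfcₙ f a) := by
      rw [cfcₙ_sub _ _ _ (by fun_prop) (by simp) (by fun_prop) (by simp),
        cfcₙ_mul _ _ _ (by fun_prop) (by simp) (by fun_prop) (by simp),
        cfcₙ_mul _ _ _ (by fun_prop) (by simp) (by fun_prop) (by simp), hka, hak, hid]
    rw [← e]
    refine norm_cfcₙ_le fun t _ => ?_
    have h1 := hbound t
    have h2 := hu t
    rw [mul_comm t (f t), hft, Real.norm_eq_abs]
    set u := (ε / 2) ^ 2 / (t ^ 2 + (ε / 2) ^ 2)
    have h3 : |t| * u ≤ ε / 2 := by rwa [mul_div_assoc] at h1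
    have e2 : t - (1 - u) * t * (1 - u) = t * (u * (2 - u)) := by ring
    rw [e2, abs_mul, abs_of_nonneg (a := u * (2 - u)) (by nlinarith)]
    nlinarith [abs_nonneg t]
  · have e : cfcₙ (fun t => t - t * (f t * t) - (t * f t) * t + (t * f t) * t * (f t * t)) a =
        a - a * (cfcₙ f a * a) - (a * cfcₙ f a) * a
          + (a * cfcₙ f a) * a * (cfcₙ f a * a) := by
      rw [cfcₙ_add _ _ _ (by fun_prop) (by simp) (by fun_prop) (by simp),
        cfcₙ_sub _ _ _ (by fun_prop) (by simp) (by fun_prop) (by simp),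
        cfcₙ_sub _ _ _ (by fun_prop) (by simp) (by fun_prop) (by simp),
        cfcₙ_mul (fun t => t) (fun t => f t * t) _ (by fun_prop) (by simp) (by fun_prop) (by simp),
        cfcₙ_mul (fun t => t * f t * t) (fun t => f t * t) _
          (by fun_prop) (by simp) (by fun_prop) (by simp),
        cfcₙ_mul (fun t => t * f t) (fun t => t) _ (by fun_prop) (by simp) (by fun_prop) (by simp),
        hka, hak, hid]
    rw [← e]
    refine norm_cfcₙ_le fun t _ => ?_
    have h1 := hbound t
    have h2 := hu t
    rw [mul_comm t (f t), hft, Real.norm_eq_abs]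
    set u := (ε / 2) ^ 2 / (t ^ 2 + (ε / 2) ^ 2)
    have h3 : |t| * u ≤ ε / 2 := by rwa [mul_div_assoc] at h1
    have e2 : t - t * (1 - u) - (1 - u) * t + (1 - u) * t * (1 - u) = t * (u * u) := by ring
    rw [e2, abs_mul, abs_of_nonneg (a := u * u) (by nlinarith)]
    nlinarith [abs_nonneg t, mul_nonneg (abs_nonneg t) h2.1]

theorem mem_leftIdeal_of_star_mul_self_le {z y : D} (h : star z * z ≤ y) : z ∈ leftIdeal y := by
  intro ε hε
  have hy : 0 ≤ y := (star_mul_self_nonneg z).trans h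
  obtain ⟨k, hk, hkc, -, hk2⟩ := exists_localUnit hy (ε := ε ^ 2 / 2) (by positivity)
  refine ⟨z * k, ?_⟩
  obtain ⟨s, hs⟩ := CStarAlgebra.nonneg_iff_eq_star_mul_self.1 (sub_nonneg.2 h)
  have e : y - y * (k * y) - (y * k) * y + (y * k) * y * (k * y) -
      star (z - z * k * y) * (z - z * k * y) = star (s - s * k * y) * (s - s * k * y) := by
    have hys : star y = y := hy.isSelfAdjoint.star_eq
    have e1 : ∀ w : D, star (w - w * k * y) * (w - w * k * y) =
        star w * w - (star w * w) * (k * y) - (y * k) * (star w * w)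
          + (y * k) * (star w * w) * (k * y) := by
      intro w
      simp only [star_sub, star_mul, hys, hk, mul_sub, sub_mul, mul_assoc]
      abel
    rw [e1, e1, ← hs]
    simp only [mul_sub, sub_mul]
    abel
  have hle : star (z - z * k * y) * (z - z * k * y) ≤
      y - y * (k * y) - (y * k) * y + (y * k) * y * (k * y) := by
    rw [← sub_nonneg, e]
    exact star_mul_self_nonneg _
  have h1 := CStarAlgebra.norm_le_norm_of_nonneg_of_le (star_mul_self_nonneg _) hle
  rw [CStarRing.norm_star_mul_self] at h1
  have h2 : ‖z - z * k * y‖ * ‖z - z * k * y‖ ≤ ε ^ 2 / 2 := h1.trans hk2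
  nlinarith [norm_nonneg (z - z * k * y)]

theorem mul_star_cuntzBelow {z y : D} (hy : 0 ≤ y) (h : z ∈ leftIdeal y) :
    CuntzBelow (z * star z) y := by
  refine cuntzBelow_of_forall_near fun ε hε => ?_
  obtain ⟨δ, hδ, hδ'⟩ := exists_pos_mul_lt_of_nonneg
    (K := 2 * ‖z‖ + 1) (by positivity) hε
  obtain ⟨x, hx⟩ := h (min δ 1) (by positivity)
  have hx1 : ‖z - x * y‖ ≤ δ := hx.le.trans (min_le_left _ _)
  have hx2 : ‖z - x * y‖ ≤ 1 := hx.le.trans (min_le_right _ _)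
  obtain ⟨g, hg, -, hgg⟩ := exists_sqrt hy
  refine ⟨(x * y) * star (x * y), ?_, ?_⟩
  · have e : z * star z - x * y * star (x * y) =
        (z - x * y) * star z + (x * y) * star (z - x * y) := by
      simp only [star_sub, mul_sub, sub_mul]; abel
    have h3 : ‖x * y‖ ≤ ‖z‖ + 1 := by
      have : x * y = z - (z - x * y) := by abel
      rw [this]
      exact (norm_sub_le _ _).trans (by linarith)
    rw [e]
    refine (norm_add_le _ _).trans ?_
    have h4 := norm_mul_le (z - x * y) (star z)
    have h5 := norm_mul_le (x * y) (star (z - x * y))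
    rw [norm_star] at h4 h5
    nlinarith [norm_nonneg z, norm_nonneg (z - x * y), norm_nonneg (x * y)]
  · have e : x * y * star (x * y) = (x * g) * y * star (x * g) := by
      rw [star_mul, star_mul, hg, hy.isSelfAdjoint.star_eq, ← hgg]
      simp only [mul_assoc]
    rw [e]
    exact cuntzBelow_conjugate _ _

theorem sqrt_mem_leftIdeal {g y : D} (hg : star g = g) (h : g * g = y) : g ∈ leftIdeal y :=
  mem_leftIdeal_of_star_mul_self_le (by rw [hg, h])

theorem _root_.CuntzBelow.of_le {x y : D} (hx : 0 ≤ x) (h : x ≤ y) : CuntzBelow x y := by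
  obtain ⟨g, hg, -, hgg⟩ := exists_sqrt hx
  have := mul_star_cuntzBelow (z := g) (hx.trans h)
    (mem_leftIdeal_of_star_mul_self_le (by rwa [hg, hgg]))
  rwa [hg, hgg] at this

theorem _root_.CuntzBelow.refl {x : D} (hx : 0 ≤ x) : CuntzBelow x x := CuntzBelow.of_le hx le_rfl

theorem mul_star_cuntzBelow_star_mul (z : D) : CuntzBelow (z * star z) (star z * z) :=
  mul_star_cuntzBelow (star_mul_self_nonneg z) (mem_leftIdeal_of_star_mul_self_le le_rfl)

theorem star_mul_cuntzBelow_mul_star (z : D) : CuntzBelow (star z * z) (z * star z) := by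
  simpa using mul_star_cuntzBelow_star_mul (star z)

theorem _root_.CuntzBelow.of_le_smul {x y : D} (hx : 0 ≤ x) {c : ℝ} (hc : 0 < c) (h : x ≤ c • y) :
    CuntzBelow x y := (CuntzBelow.of_le hx h).of_smul_right hc

theorem mem_leftIdeal_of_le_smul {z y : D} {c : ℝ} (h : star z * z ≤ c • y) :
    z ∈ leftIdeal y := by
  intro ε hε
  obtain ⟨x, hx⟩ := mem_leftIdeal_of_star_mul_self_le h ε hε
  exact ⟨c • x, by rwa [smul_mul_assoc, ← mul_smul_comm]⟩

theorem cuntzBelow_cube {a : D} (ha : 0 ≤ a) : CuntzBelow a (a * a * a) := by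
  refine cuntzBelow_of_forall_near fun ε hε => ?_
  obtain ⟨k, hk, hkc, h, -⟩ := exists_localUnit ha hε
  refine ⟨_, h, ?_⟩
  have e : k * a * a * (a * k) = k * (a * a * a) * star k := by
    rw [hk]; simp only [mul_assoc]
  rw [e]
  exact cuntzBelow_conjugate _ _

theorem cuntzBelow_sq {a : D} (ha : 0 ≤ a) : CuntzBelow a (a * a) := by
  refine (cuntzBelow_cube ha).trans ?_
  obtain ⟨g, hg, -, hgg⟩ := exists_sqrt ha
  have e : a * a * a = g * (a * a) * star g := by
    rw [hg, ← hgg]; simp only [mul_assoc]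
  rw [e]
  exact cuntzBelow_conjugate _ _

theorem _root_.CuntzBelow.of_mem_leftIdeal {p y : D} (hp : 0 ≤ p) (hy : 0 ≤ y) (h : p ∈ leftIdeal y) :
    CuntzBelow p y := by
  refine (cuntzBelow_sq hp).trans ?_
  have := mul_star_cuntzBelow hy h
  rwa [hp.isSelfAdjoint.star_eq] at this

end Order

variable {D : Type*} [NonUnitalCStarAlgebra D]

/-- The cut-down `(a - ε)₊`. -/
noncomputable def cut (ε : ℝ) (a : D) : D := cfcₙ (fun t : ℝ => max (t - ε) 0) a

theorem continuous_max_sub (ε : ℝ) : Continuous fun t : ℝ => max (t - ε) 0 := by fun_prop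

theorem max_zero_sub {ε : ℝ} (hε : 0 ≤ ε) : max ((0 : ℝ) - ε) 0 = 0 := by simpa using hε

theorem mul_eq_zero_of_mem_leftIdeal {z a b : D} (hz : z ∈ leftIdeal a) (hab : a * b = 0) :
    z * b = 0 := by
  rw [← norm_le_zero_iff]
  refine le_of_forall_pos_le_add fun ε hε => ?_
  obtain ⟨δ, hδ, hδ'⟩ := exists_pos_mul_lt_of_nonneg (norm_nonneg b) hε
  obtain ⟨x, hx⟩ := hz δ hδ
  have e : z * b = (z - x * a) * b := by rw [sub_mul, mul_assoc, hab, mul_zero, sub_zero]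
  rw [e]
  have h1 := norm_mul_le (z - x * a) b
  nlinarith [norm_nonneg b]

variable [PartialOrder D] [StarOrderedRing D]

theorem cut_nonneg (ε : ℝ) (a : D) : 0 ≤ cut ε a :=
  cfcₙ_nonneg fun _ _ => le_max_right _ _

theorem self_mem_leftIdeal {a : D} (ha : 0 ≤ a) : a ∈ leftIdeal a := by
  obtain ⟨g, hg, -, hgg⟩ := exists_sqrt ha
  have := mul_mem_leftIdeal g (sqrt_mem_leftIdeal hg hgg)
  rwa [hgg] at this

theorem norm_sub_cut_le {a : D} (ha : 0 ≤ a) {ε : ℝ} (hε : 0 ≤ ε) : ‖a - cut ε a‖ ≤ ε := by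
  have hs : IsSelfAdjoint a := ha.isSelfAdjoint
  have e : cfcₙ (fun t : ℝ => t - max (t - ε) 0) a = a - cut ε a := by
    rw [cfcₙ_sub (fun t : ℝ => t) (fun t => max (t - ε) 0) a (by fun_prop) (by simp)
      (by fun_prop) (max_zero_sub hε), cfcₙ_id' ℝ a]
    rfl
  rw [← e]
  refine norm_cfcₙ_le fun t ht => ?_
  have h0 : 0 ≤ t := quasispectrum_nonneg_of_nonneg a ha t ht
  rw [Real.norm_eq_abs, abs_le]
  rcases max_cases (t - ε) 0 with h | h <;> constructor <;> linarith

theorem cut_anti {a : D} {ε δ : ℝ} (hε : 0 ≤ ε) (h : ε ≤ δ) : cut δ a ≤ cut ε a :=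
  cfcₙ_mono (fun t _ => max_le_max (by linarith) le_rfl) (continuous_max_sub _).continuousOn
    (continuous_max_sub _).continuousOn (max_zero_sub (hε.trans h)) (max_zero_sub hε)

theorem cut_le_self {a : D} (ha : 0 ≤ a) {ε : ℝ} (hε : 0 ≤ ε) : cut ε a ≤ a := by
  have hs : IsSelfAdjoint a := ha.isSelfAdjoint
  conv_rhs => rw [← cfcₙ_id' ℝ a]
  refine cfcₙ_mono (fun t ht => ?_) (continuous_max_sub _).continuousOn
    (by fun_prop) (max_zero_sub hε) rfl
  have h0 : 0 ≤ t := quasispectrum_nonneg_of_nonneg a ha t ht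
  exact max_le (by linarith) h0

theorem cut_cuntzBelow {a : D} (ha : 0 ≤ a) {ε : ℝ} (hε : 0 ≤ ε) : CuntzBelow (cut ε a) a :=
  CuntzBelow.of_le (cut_nonneg _ _) (cut_le_self ha hε)

theorem exists_cutRoot {a : D} (ha : 0 ≤ a) {ε η : ℝ} (hε : 0 ≤ ε) (hη : 0 < η) :
    ∃ G : D, star G = G ∧ G ∈ leftIdeal a ∧ ‖cut ε a - (G * a * G - ε • (G * G))‖ ≤ η ∧
      0 ≤ G * a * G - ε • (G * G) := by
  have hs : IsSelfAdjoint a := ha.isSelfAdjoint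
  set u : ℝ → ℝ := fun t => max (t - ε) 0 with hu
  have huc : Continuous u := continuous_max_sub ε
  have hu0 : u 0 = 0 := max_zero_sub hε
  have hun : ∀ t, 0 ≤ u t := fun t => le_max_right _ _
  have hden : ∀ t, 0 < u t + η := fun t => by have := hun t; linarith
  set f : ℝ → ℝ := fun t => √(u t / (u t + η)) with hf
  have hfc : Continuous f :=
    (huc.div (huc.add continuous_const) fun t => (hden t).ne').sqrt
  have hf0 : f 0 = 0 := by simp [hf, hu0]
  have hff : ∀ t, f t * f t = u t / (u t + η) := fun t =>
    Real.mul_self_sqrt (div_nonneg (hun t) (hden t).le)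
  have hGG : cfcₙ (fun t => f t * f t) a = cfcₙ f a * cfcₙ f a :=
    cfcₙ_mul _ _ _ hfc.continuousOn hf0 hfc.continuousOn hf0
  have hGaG : cfcₙ (fun t => f t * t * f t) a = cfcₙ f a * a * cfcₙ f a := by
    rw [cfcₙ_mul _ _ _ (by fun_prop) (by simp) hfc.continuousOn hf0,
      cfcₙ_mul _ _ _ (by fun_prop) hf0 (by fun_prop) (by simp), cfcₙ_id' ℝ a]
  have hmain : cfcₙ (fun t => f t * t * f t - ε • (f t * f t)) a =
      cfcₙ f a * a * cfcₙ f a - ε • (cfcₙ f a * cfcₙ f a) := by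
    rw [cfcₙ_sub _ _ _ (by fun_prop) (by simp) (by fun_prop) (by simp [hf0]),
      cfcₙ_smul _ _ _ (by fun_prop) (by simp [hf0]), hGG, hGaG]
  have hval : ∀ t, f t * t * f t - ε • (f t * f t) = u t * (u t / (u t + η)) := fun t => by
    have h1 : f t * t * f t - ε • (f t * f t) = (t - ε) * (f t * f t) := by
      rw [smul_eq_mul]; ring
    rw [h1, hff]
    rcases le_total 0 (t - ε) with h | h
    · rw [show u t = t - ε from max_eq_left h]
    · rw [show u t = 0 from max_eq_right h]; simp
  refine ⟨cfcₙ f a, (cfcₙ_predicate f a).star_eq, ?_, ?_, ?_⟩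
  · refine mem_leftIdeal_of_le_smul (c := η⁻¹) ?_
    rw [(cfcₙ_predicate f a).star_eq, ← hGG]
    conv_rhs => rw [← cfcₙ_const_mul_id η⁻¹ a]
    refine cfcₙ_mono (fun t ht => ?_) (by fun_prop) (by fun_prop) (by simp [hf0]) (by simp)
    have h0 : 0 ≤ t := quasispectrum_nonneg_of_nonneg a ha t ht
    have hut : u t ≤ t := max_le (by linarith) h0
    rw [hff, inv_mul_eq_div]
    gcongr
    linarith [hun t]
  · have e : cfcₙ (fun t => u t - (f t * t * f t - ε • (f t * f t))) a =
        cut ε a - (cfcₙ f a * a * cfcₙ f a - ε • (cfcₙ f a * cfcₙ f a)) := by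
      rw [cfcₙ_sub _ _ _ (by fun_prop) hu0 (by fun_prop) (by simp [hf0]), hmain]
      rfl
    rw [← e]
    refine norm_cfcₙ_le fun t _ => ?_
    rw [hval]
    have h1 : u t - u t * (u t / (u t + η)) = η * (u t / (u t + η)) := by
      have := (hden t).ne'
      field_simp
      ring
    have h2 : u t / (u t + η) ≤ 1 := by
      rw [div_le_one (hden t)]; linarith
    have h3 : 0 ≤ u t / (u t + η) := div_nonneg (hun t) (hden t).le
    rw [h1, Real.norm_eq_abs, abs_of_nonneg (by positivity)]
    nlinarith
  · rw [← hmain]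
    refine cfcₙ_nonneg fun t _ => ?_
    rw [hval]
    exact mul_nonneg (hun t) (div_nonneg (hun t) (hden t).le)

/-- Cut-downs of orthogonal positive elements are dominated by any positive element which is
sufficiently close to the sum. -/
theorem cut_add_cut_cuntzBelow {a b c : D} (ha : 0 ≤ a) (hb : 0 ≤ b) (hc : 0 ≤ c)
    (hab : a * b = 0) {ε : ℝ} (hε : 0 ≤ ε) (h : ‖a + b - c‖ ≤ ε) :
    CuntzBelow (cut ε a + cut ε b) c := by
  have hba : b * a = 0 := by
    have := congrArg star hab
    rwa [star_mul, ha.isSelfAdjoint.star_eq, hb.isSelfAdjoint.star_eq, star_zero] at this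
  refine cuntzBelow_of_forall_near fun η hη => ?_
  obtain ⟨G, hG, hGl, hGn, hG0⟩ := exists_cutRoot ha hε (half_pos hη)
  obtain ⟨H, hH, hHl, hHn, hH0⟩ := exists_cutRoot hb hε (half_pos hη)
  refine ⟨(G * a * G - ε • (G * G)) + (H * b * H - ε • (H * H)), ?_, ?_⟩
  · rw [add_sub_add_comm]
    exact (norm_add_le _ _).trans (by linarith)
  · have hGb : G * b = 0 := mul_eq_zero_of_mem_leftIdeal hGl hab
    have hHa : H * a = 0 := mul_eq_zero_of_mem_leftIdeal hHl hba
    have haH : a * H = 0 := by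
      have := congrArg star hHa
      rwa [star_mul, ha.isSelfAdjoint.star_eq, hH, star_zero] at this
    have hGH : G * H = 0 := mul_eq_zero_of_mem_leftIdeal hGl haH
    have hHG : H * G = 0 := by
      have := congrArg star hGH
      rwa [star_mul, hG, hH, star_zero] at this
    have hSA : star (G + H) = G + H := by rw [star_add, hG, hH]
    have e : (G * a * G - ε • (G * G)) + (H * b * H - ε • (H * H)) =
        (G + H) * (a + b) * (G + H) - ε • ((G + H) * (G + H)) := by
      have h1 : (G + H) * (a + b) = G * a + H * b := by
        rw [add_mul, mul_add, mul_add, hGb, hHa]; abel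
      have h2 : b * G = 0 := by
        have := congrArg star hGb
        rwa [star_mul, hb.isSelfAdjoint.star_eq, hG, star_zero] at this
      rw [h1]
      simp only [add_mul, mul_add, hGH, hHG, mul_assoc, haH, h2, mul_zero, add_zero, zero_add,
        smul_add]
      abel
    have h3 : IsSelfAdjoint (a + b - c) :=
      (ha.isSelfAdjoint.add hb.isSelfAdjoint).sub hc.isSelfAdjoint
    have h4 : (G + H) * (a + b - c) * (G + H) ≤ ε • ((G + H) * (G + H)) := by
      have h5 := CStarAlgebra.star_left_conjugate_le_norm_smul (a := G + H) h3
      rw [hSA] at h5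
      refine h5.trans (smul_le_smul_of_nonneg_right h ?_)
      have := star_mul_self_nonneg (G + H)
      rwa [hSA] at this
    have h6 : (G + H) * (a + b) * (G + H) - ε • ((G + H) * (G + H)) ≤
        (G + H) * c * star (G + H) := by
      rw [mul_sub, sub_mul] at h4
      rw [hSA]
      exact sub_le_comm.1 h4
    rw [e]
    refine (CuntzBelow.of_le ?_ h6).trans (cuntzBelow_conjugate _ _)
    rw [← e]
    exact add_nonneg hG0 hH0

theorem cut_cuntzBelow_of_norm_sub_le {a b : D} (ha : 0 ≤ a) (hb : 0 ≤ b) {ε : ℝ}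
    (h : ‖a - b‖ ≤ ε) : CuntzBelow (cut ε a) b := by
  have hε : 0 ≤ ε := (norm_nonneg _).trans h
  have h1 := cut_add_cut_cuntzBelow ha le_rfl hb (mul_zero a) hε (by rwa [add_zero])
  have h2 : cut ε (0 : D) = 0 := le_antisymm (cut_le_self le_rfl hε) (cut_nonneg _ _)
  rwa [h2, add_zero] at h1

theorem cuntzBelow_of_forall_cut {a b : D} (ha : 0 ≤ a)
    (h : ∀ ε : ℝ, 0 < ε → CuntzBelow (cut ε a) b) : CuntzBelow a b :=
  cuntzBelow_of_forall_near fun ε hε => ⟨_, norm_sub_cut_le ha hε.le, h ε hε⟩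

theorem _root_.CuntzBelow.exists_cut {a b : D} (ha : 0 ≤ a) (hb : 0 ≤ b) (h : CuntzBelow a b)
    {ε : ℝ} (hε : 0 < ε) : ∃ δ : ℝ, 0 < δ ∧ CuntzBelow (cut ε a) (cut δ b) := by
  obtain ⟨r, hr⟩ := cuntzBelow_iff.1 h (ε / 2) (by positivity)
  obtain ⟨δ, hδ, hδ'⟩ := exists_pos_mul_lt_of_nonneg (sq_nonneg ‖r‖) (half_pos hε)
  refine ⟨δ, hδ, ?_⟩
  refine (cut_cuntzBelow_of_norm_sub_le ha (nonneg_conjugate (cut_nonneg δ b) r) ?_).trans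
    (cuntzBelow_conjugate r _)
  have e : a - r * cut δ b * star r = (a - r * b * star r) + r * (b - cut δ b) * star r := by
    simp only [mul_sub, sub_mul]; abel
  have h1 := norm_conjugate_le r (b - cut δ b)
  have h2 : ‖r‖ ^ 2 * ‖b - cut δ b‖ ≤ ‖r‖ ^ 2 * δ := by
    gcongr; exact norm_sub_cut_le hb hδ.le
  rw [e]
  exact (norm_add_le _ _).trans (by linarith)

/-- If `a ≼ b`, then `a` is approximated from below by elements of the form `r b r*`. -/
theorem _root_.CuntzBelow.exists_conjugate {a b : D} (ha : 0 ≤ a) (hb : 0 ≤ b)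
    (h : CuntzBelow a b) {ε : ℝ} (hε : 0 < ε) :
    ∃ r : D, CuntzBelow (r * b * star r) a ∧ CuntzBelow (cut ε a) (r * b * star r) := by
  obtain ⟨r, hr⟩ := cuntzBelow_iff.1 h (ε / 2) (by positivity)
  set p := r * b * star r with hp
  have hp0 : 0 ≤ p := nonneg_conjugate hb r
  set u := cut (ε / 2) p with hu
  have hu0 : 0 ≤ u := cut_nonneg _ _
  have hus : star u = u := hu0.isSelfAdjoint.star_eq
  have e : u * r * b * star (u * r) = u * p * u := by
    rw [star_mul, hus, hp]; simp only [mul_assoc]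
  have hupu : 0 ≤ u * p * u := by
    have := nonneg_conjugate hp0 u
    rwa [hus] at this
  refine ⟨u * r, ?_, ?_⟩
  · rw [e]
    refine (CuntzBelow.of_mem_leftIdeal hupu hu0
      (mul_mem_leftIdeal _ (self_mem_leftIdeal hu0))).trans ?_
    exact cut_cuntzBelow_of_norm_sub_le hp0 ha (by rw [norm_sub_rev]; exact hr.le)
  · rw [e]
    have h1 : ‖a - u‖ ≤ ε := by
      have e2 : a - u = (a - p) + (p - u) := by abel
      have h3 := norm_sub_cut_le hp0 (half_pos hε).le
      rw [e2]
      exact (norm_add_le _ _).trans (by linarith)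
    refine (cut_cuntzBelow_of_norm_sub_le ha hu0 h1).trans ((cuntzBelow_cube hu0).trans ?_)
    have h2 : u ≤ p := cut_le_self hp0 (half_pos hε).le
    have h4 := star_left_conjugate_le_conjugate h2 u
    rw [hus] at h4
    refine CuntzBelow.of_le ?_ h4
    have := nonneg_conjugate hu0 u
    rwa [hus] at this

theorem add_cuntzBelow_add {a b a' b' : D} (ha' : 0 ≤ a') (hb' : 0 ≤ b') (h0 : a' * b' = 0)
    (ha : CuntzBelow a a') (hb : CuntzBelow b b') : CuntzBelow (a + b) (a' + b') := by
  have h0' : b' * a' = 0 := by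
    have := congrArg star h0
    rwa [star_mul, ha'.isSelfAdjoint.star_eq, hb'.isSelfAdjoint.star_eq, star_zero] at this
  have key : ∀ {x y : D}, 0 ≤ y → CuntzBelow x y → ∀ ε : ℝ, 0 < ε →
      ∃ w : D, ‖x - (w * y) * y * star (w * y)‖ ≤ ε := by
    intro x y hy hxy ε hε
    obtain ⟨r, hr⟩ := cuntzBelow_iff.1 hxy (ε / 2) (by positivity)
    obtain ⟨δ, hδ, hδ'⟩ := exists_pos_mul_lt_of_nonneg (sq_nonneg ‖r‖) (half_pos hε)
    obtain ⟨k, hk, hkc, hk1, -⟩ := exists_localUnit hy hδ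
    refine ⟨r * k, ?_⟩
    have e : x - (r * k * y) * y * star (r * k * y) =
        (x - r * y * star r) + r * (y - k * y * y * (y * k)) * star r := by
      simp only [star_mul, hk, hy.isSelfAdjoint.star_eq, mul_sub, sub_mul, mul_assoc]; abel
    have h1 := norm_conjugate_le r (y - k * y * y * (y * k))
    have h2 : ‖r‖ ^ 2 * ‖y - k * y * y * (y * k)‖ ≤ ‖r‖ ^ 2 * δ := by gcongr
    rw [e]
    exact (norm_add_le _ _).trans (by linarith)
  refine cuntzBelow_of_forall_near fun ε hε => ?_
  obtain ⟨r, hr⟩ := key ha' ha (ε / 2) (by positivity)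
  obtain ⟨s, hs⟩ := key hb' hb (ε / 2) (by positivity)
  refine ⟨(r * a' + s * b') * (a' + b') * star (r * a' + s * b'), ?_, cuntzBelow_conjugate _ _⟩
  have e : (r * a' + s * b') * (a' + b') * star (r * a' + s * b') =
      (r * a') * a' * star (r * a') + (s * b') * b' * star (s * b') := by
    simp only [star_add, star_mul, ha'.isSelfAdjoint.star_eq, hb'.isSelfAdjoint.star_eq]
    have h1 : (r * a' + s * b') * (a' + b') = r * a' * a' + s * b' * b' := by
      rw [add_mul, mul_add, mul_add, mul_assoc r a' b', h0, mul_assoc s b' a', h0']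
      simp
    have h2 : ∀ x : D, a' * (b' * x) = 0 := fun x => by rw [← mul_assoc, h0, zero_mul]
    have h3 : ∀ x : D, b' * (a' * x) = 0 := fun x => by rw [← mul_assoc, h0', zero_mul]
    rw [h1]
    simp only [mul_add, add_mul, mul_assoc, h2, h3, mul_zero, add_zero, zero_add]
  rw [e, add_sub_add_comm]
  exact (norm_add_le _ _).trans (by linarith)

section Sup

variable {D : Type*} [NonUnitalCStarAlgebra D]

/-- A sequence of left multiplications by isometries with pairwise orthogonal ranges. -/
def IsShiftSystem (L : ℕ → D → D) : Prop :=
  ∀ i j x y, star (L i x) * L j y = if i = j then star x * y else 0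

theorem exists_dependent_seq {α : Type*} (P : ℕ → α → Prop) (R : ℕ → α → α → Prop)
    (h0 : ∃ a, P 0 a) (hs : ∀ n a, P n a → ∃ a', P (n + 1) a' ∧ R n a a') :
    ∃ f : ℕ → α, (∀ n, P n (f n)) ∧ ∀ n, R n (f n) (f (n + 1)) := by
  choose g hg using hs
  let F : ∀ n, {a // P n a} := fun n =>
    Nat.rec ⟨h0.choose, h0.choose_spec⟩ (fun n p => ⟨g n p.1 p.2, (hg n p.1 p.2).1⟩) n
  exact ⟨fun n => (F n).1, fun n => (F n).2, fun n => (hg n (F n).1 (F n).2).2⟩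

theorem IsShiftSystem.star_mul_self {L : ℕ → D → D} (hL : IsShiftSystem L) (i : ℕ) (x : D) :
    star (L i x) * L i x = star x * x := by rw [hL, if_pos rfl]

theorem IsShiftSystem.star_mul_of_ne {L : ℕ → D → D} (hL : IsShiftSystem L) {i j : ℕ}
    (h : i ≠ j) (x y : D) : star (L i x) * L j y = 0 := by rw [hL, if_neg h]

variable [PartialOrder D] [StarOrderedRing D]

theorem exists_sup_step {L : ℕ → D → D} (hL : IsShiftSystem L) {n : ℕ} {q b : D}
    (hq : 0 ≤ q) (hb : 0 ≤ b) (hqL : ∀ j, n < j → ∀ w, q * L j w = 0) (hqb : CuntzBelow q b)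
    {ε : ℝ} (hε : 0 < ε) :
    ∃ q' : D, 0 ≤ q' ∧ CuntzBelow b q' ∧ CuntzBelow q' b ∧ ‖q' - q‖ ≤ ε ∧
      ∀ j, n + 1 < j → ∀ w, q' * L j w = 0 := by
  obtain ⟨k, hk, hkc, hk1, -⟩ := exists_localUnit hq (ε := ε / 4) (by positivity)
  obtain ⟨δ, hδ, hδ'⟩ := exists_pos_mul_lt_of_nonneg (sq_nonneg ‖k * q‖)
    (ε := ε / 4) (by positivity)
  obtain ⟨r, hr⟩ := cuntzBelow_iff.1 hqb δ hδ
  obtain ⟨g, hg, -, hgg⟩ := exists_sqrt hb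
  have hqs : star q = q := hq.isSelfAdjoint.star_eq
  set Z := k * q * r * g with hZ
  have hZ1 : ‖Z * star Z - q‖ ≤ ε / 2 := by
    have e : Z * star Z - q =
        -((q - k * q * q * (q * k)) + (k * q) * (q - r * b * star r) * star (k * q)) := by
      rw [hZ, ← hgg]
      simp only [star_mul, hk, hqs, hg, mul_sub, sub_mul, mul_assoc]; abel
    rw [e, norm_neg]
    have h1 := norm_conjugate_le (k * q) (q - r * b * star r)
    have h2 : ‖k * q‖ ^ 2 * ‖q - r * b * star r‖ ≤ ‖k * q‖ ^ 2 * δ := by gcongr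
    exact (norm_add_le _ _).trans (by linarith)
  have hZL : ∀ j, n < j → ∀ w, star Z * L j w = 0 := fun j hj w => by
    rw [hZ, hkc]
    simp only [star_mul, hqs, mul_assoc, hqL j hj w, mul_zero]
  set V := L (n + 1) g with hV
  have hZV : star Z * V = 0 := hZL _ (Nat.lt_succ_self n) _
  have hVZ : star V * Z = 0 := by
    have := congrArg star hZV
    rwa [star_mul, star_star, star_zero] at this
  have hVV : star V * V = b := by rw [hV, hL.star_mul_self, hg, hgg]
  obtain ⟨η₀, hη₀, hη₀'⟩ := exists_pos_mul_lt_of_nonneg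
    (K := 2 * (‖Z‖ * ‖V‖) + ‖V‖ * ‖V‖) (by positivity) (half_pos hε)
  set η := min η₀ 1 with hη
  have hη0 : 0 < η := by positivity
  have hη1 : η ≤ 1 := min_le_right _ _
  have hη2 : (2 * (‖Z‖ * ‖V‖) + ‖V‖ * ‖V‖) * η ≤ ε / 2 :=
    (mul_le_mul_of_nonneg_left (min_le_left _ _) (by positivity)).trans hη₀'.le
  set X := Z + η • V with hX
  have hXX : star X * X = star Z * Z + (η * η) • b := by
    rw [hX, star_add, star_smul, star_trivial η, add_mul, mul_add, mul_add, mul_smul_comm,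
      smul_mul_assoc, smul_mul_assoc, mul_smul_comm, hZV, hVZ, hVV, smul_smul]
    simp
  have hb1 : CuntzBelow b (star X * X) := by
    refine CuntzBelow.of_le_smul hb (c := (η * η)⁻¹) (by positivity) ?_
    rw [hXX, smul_add, smul_smul, inv_mul_cancel₀ (by positivity), one_smul]
    exact le_add_of_nonneg_left (smul_nonneg (by positivity) (star_mul_self_nonneg Z))
  have hb2 : CuntzBelow (star X * X) b := by
    refine CuntzBelow.of_mem_leftIdeal (star_mul_self_nonneg X) hb ?_
    have hgl := sqrt_mem_leftIdeal hg hgg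
    have e : star X * X = (star Z * (k * q * r) + (η * η) • g) * g := by
      rw [hXX, add_mul, smul_mul_assoc, hgg, mul_assoc (star Z)]
    rw [e]
    exact mul_mem_leftIdeal _ hgl
  refine ⟨X * star X, mul_star_self_nonneg X, hb1.trans (star_mul_cuntzBelow_mul_star X),
    (mul_star_cuntzBelow_star_mul X).trans hb2, ?_, fun j hj w => ?_⟩
  · have e : X * star X - q = (Z * star Z - q) +
        (η • (Z * star V) + (η • (V * star Z) + (η * η) • (V * star V))) := by
      rw [hX, star_add, star_smul, star_trivial η, add_mul, mul_add, mul_add, mul_smul_comm,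
      smul_mul_assoc, smul_mul_assoc, mul_smul_comm, smul_smul]
      abel
    have n1 : ‖η • (Z * star V)‖ ≤ η * (‖Z‖ * ‖V‖) := by
      rw [norm_smul, Real.norm_of_nonneg hη0.le]
      gcongr
      simpa using norm_mul_le Z (star V)
    have n2 : ‖η • (V * star Z)‖ ≤ η * (‖Z‖ * ‖V‖) := by
      rw [norm_smul, Real.norm_of_nonneg hη0.le, mul_comm ‖Z‖]
      gcongr
      simpa using norm_mul_le V (star Z)
    have n3 : ‖(η * η) • (V * star V)‖ ≤ η * (‖V‖ * ‖V‖) := by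
      rw [norm_smul, Real.norm_of_nonneg (by positivity)]
      gcongr
      · nlinarith
      · simpa using norm_mul_le V (star V)
    rw [e]
    refine (norm_add_le _ _).trans ?_
    have m1 := norm_add_le (η • (Z * star V)) (η • (V * star Z) + (η * η) • (V * star V))
    have m2 := norm_add_le (η • (V * star Z)) ((η * η) • (V * star V))
    linarith
  · have h1 : star X * L j w = 0 := by
      rw [hX, star_add, add_mul, hZL j (by omega) w, star_smul, smul_mul_assoc, hV,
        hL.star_mul_of_ne (by omega), smul_zero, add_zero]
    rw [mul_assoc, h1, mul_zero]

theorem exists_sup {L : ℕ → D → D} (hL : IsShiftSystem L) {b : ℕ → D} (hb : ∀ n, 0 ≤ b n)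
    (hbm : ∀ n m, n ≤ m → CuntzBelow (b n) (b m)) :
    ∃ a : D, 0 ≤ a ∧ (∀ n, CuntzBelow (b n) a) ∧
      ∀ δ : ℝ, 0 < δ → ∃ n, CuntzBelow (cut δ a) (b n) := by
  have htau : ∀ n (q : D), 0 ≤ q → CuntzBelow (b n) q → ∀ M : ℝ, 0 < M → ∃ τ : ℝ, 0 < τ ∧ τ ≤ M ∧
      CuntzBelow (cut (1 / ((n : ℝ) + 1)) (b n.unpair.1)) (cut τ q) := by
    intro n q hq h M hM
    obtain ⟨δ, hδ, h1⟩ := ((hbm _ _ n.unpair_left_le).trans h).exists_cut (hb _) hq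
      (ε := 1 / ((n : ℝ) + 1)) (by positivity)
    exact ⟨min δ M, by positivity, min_le_right _ _, h1.trans
      (CuntzBelow.of_le (cut_nonneg _ _) (cut_anti (by positivity) (min_le_left _ _)))⟩
  obtain ⟨f, hf, hfr⟩ := exists_dependent_seq
    (fun n (p : D × ℝ) => 0 ≤ p.1 ∧ CuntzBelow (b n) p.1 ∧ CuntzBelow p.1 (b n) ∧
      (∀ j, n < j → ∀ w, p.1 * L j w = 0) ∧ 0 < p.2 ∧ p.2 ≤ 1 / ((n : ℝ) + 1) ∧
      CuntzBelow (cut (1 / ((n : ℝ) + 1)) (b n.unpair.1)) (cut p.2 p.1))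
    (fun _ p p' => ‖p'.1 - p.1‖ ≤ p.2 / 2 ∧ p'.2 ≤ p.2 / 2)
    (by
      obtain ⟨g, hg, -, hgg⟩ := exists_sqrt (hb 0)
      have h1 : star (L 0 g) * L 0 g = b 0 := by rw [hL.star_mul_self, hg, hgg]
      have h2 := star_mul_cuntzBelow_mul_star (L 0 g)
      have h3 := mul_star_cuntzBelow_star_mul (L 0 g)
      rw [h1] at h2 h3
      obtain ⟨τ, hτ, hτ1, hτ2⟩ := htau 0 _ (mul_star_self_nonneg (L 0 g)) h2 1 one_pos
      refine ⟨(L 0 g * star (L 0 g), τ), mul_star_self_nonneg _, h2, h3, fun j hj w => ?_, hτ,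
        by simpa using hτ1, hτ2⟩
      rw [mul_assoc, hL.star_mul_of_ne hj.ne, mul_zero])
    (by
      rintro n ⟨q, τ⟩ ⟨h1, h2, h3, h4, h5, h6, h7⟩
      obtain ⟨q', k1, k2, k3, k4, k5⟩ := exists_sup_step hL h1 (hb (n + 1)) h4
        (h3.trans (hbm n (n + 1) (Nat.le_succ n))) (half_pos h5)
      obtain ⟨τ', t1, t2, t3⟩ := htau (n + 1) q' k1 k2 (min (τ / 2) (1 / (((n + 1 : ℕ) : ℝ) + 1)))
        (lt_min (half_pos h5) (by positivity))
      exact ⟨(q', τ'), ⟨k1, k2, k3, k5, t1, t2.trans (min_le_right _ _), t3⟩, k4,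
        t2.trans (min_le_left _ _)⟩)
  have hdist : ∀ n m, n ≤ m → ‖(f m).1 - (f n).1‖ ≤ (f n).2 - (f m).2 := by
    intro n m hnm
    induction m, hnm using Nat.le_induction with
    | base => simp
    | succ m _ ih =>
      have h1 := hfr m
      have e : (f (m + 1)).1 - (f n).1 = ((f (m + 1)).1 - (f m).1) + ((f m).1 - (f n).1) := by abel
      rw [e]
      exact (norm_add_le _ _).trans (by linarith [h1.1, h1.2])
  have hdist' : ∀ n m, n ≤ m → dist (f n).1 (f m).1 ≤ (f n).2 := fun n m h => by
    rw [dist_comm, dist_eq_norm]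
    linarith [hdist n m h, (hf m).2.2.2.2.1]
  have hτ0 : Tendsto (fun n => (f n).2) atTop (𝓝 0) :=
    squeeze_zero (fun n => (hf n).2.2.2.2.1.le) (fun n => (hf n).2.2.2.2.2.1)
      tendsto_one_div_add_atTop_nhds_zero_nat
  obtain ⟨a, ha⟩ := cauchySeq_tendsto_of_complete
    (cauchySeq_of_le_tendsto_0' (fun n => (f n).2) hdist' hτ0)
  have hclose : ∀ n, ‖(f n).1 - a‖ ≤ (f n).2 := fun n => by
    rw [← dist_eq_norm]
    exact le_of_tendsto (tendsto_const_nhds.dist ha)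
      (eventually_atTop.2 ⟨n, fun m hm => hdist' n m hm⟩)
  have ha0 : 0 ≤ a := CStarAlgebra.isClosed_nonneg.mem_of_tendsto ha
    (Eventually.of_forall fun n => (hf n).1)
  refine ⟨a, ha0, fun i => cuntzBelow_of_forall_cut (hb i) fun ε hε => ?_, fun δ hδ => ?_⟩
  · obtain ⟨M, hM⟩ := exists_nat_one_div_lt hε
    have h1 := (hf (Nat.pair i M)).2.2.2.2.2.2
    rw [Nat.unpair_pair] at h1
    refine (CuntzBelow.of_le (cut_nonneg _ _) (cut_anti (by positivity) ?_)).trans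
      (h1.trans (cut_cuntzBelow_of_norm_sub_le (hf _).1 ha0 (hclose _)))
    refine le_trans ?_ hM.le
    have := Nat.right_le_pair i M
    gcongr
  · obtain ⟨n, hn⟩ := (hτ0.eventually (ge_mem_nhds hδ)).exists
    refine ⟨n, (cut_cuntzBelow_of_norm_sub_le ha0 (hf n).1 ?_).trans (hf n).2.2.1⟩
    rw [norm_sub_rev]
    exact (hclose n).trans hn

end Sup

section Riesz

variable {D : Type*} [NonUnitalCStarAlgebra D]

theorem norm_conj_sub_le {s t a : D} {K κ : ℝ} (hs : ‖s‖ ≤ K) (ht : ‖t‖ ≤ K) (h : ‖s - t‖ ≤ κ) :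
    ‖s * a * s - t * a * t‖ ≤ 2 * K * ‖a‖ * κ := by
  have e : s * a * s - t * a * t = (s - t) * a * s + t * a * (s - t) := by
    simp only [sub_mul, mul_sub]; abel
  have hK : 0 ≤ K := (norm_nonneg _).trans hs
  have hκ : 0 ≤ κ := (norm_nonneg _).trans h
  have h1 : ‖(s - t) * a * s‖ ≤ κ * ‖a‖ * K :=
    (norm_mul_le _ _).trans (mul_le_mul ((norm_mul_le _ _).trans (by gcongr)) hs (norm_nonneg _)
      (by positivity))
  have h2 : ‖t * a * (s - t)‖ ≤ K * ‖a‖ * κ :=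
    (norm_mul_le _ _).trans (mul_le_mul ((norm_mul_le _ _).trans (by gcongr)) h (norm_nonneg _)
      (by positivity))
  rw [e]
  exact (norm_add_le _ _).trans (by linarith)

variable [PartialOrder D] [StarOrderedRing D]

/-- A local unit `H * a` acting as the identity on `cut δ a`. -/
theorem exists_unit_cut {a : D} (ha : 0 ≤ a) {δ : ℝ} (hδ : 0 < δ) :
    ∃ H e : D, star e = e ∧ e = H * a ∧ ‖e‖ ≤ 1 ∧ ‖H‖ ≤ δ⁻¹ ∧ cut δ a * e = cut δ a := by
  have hs : IsSelfAdjoint a := ha.isSelfAdjoint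
  have hm : ∀ t : ℝ, 0 < max t δ := fun t => lt_max_of_lt_right hδ
  set h : ℝ → ℝ := fun t => t / (max t δ) ^ 2 with hh
  have hc : Continuous h :=
    continuous_id.div (by fun_prop) fun t => (pow_pos (hm t) 2).ne'
  have h0 : h 0 = 0 := by simp [hh]
  have e1 : cfcₙ (fun t => h t * t) a = cfcₙ h a * a := by
    rw [cfcₙ_mul h (fun t => t) a hc.continuousOn h0 (by fun_prop) rfl, cfcₙ_id' ℝ a]
  refine ⟨cfcₙ h a, cfcₙ (fun t => h t * t) a, (cfcₙ_predicate (fun t => h t * t) a).star_eq, e1, ?_, ?_, ?_⟩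
  · refine norm_cfcₙ_le fun t _ => ?_
    have e : h t * t = (t / max t δ) ^ 2 := by simp only [hh]; ring
    rw [e, Real.norm_of_nonneg (by positivity), sq_le_one_iff_abs_le_one, abs_div,
      abs_of_pos (hm t), div_le_one (hm t)]
    rename_i ht
    rw [abs_of_nonneg (quasispectrum_nonneg_of_nonneg a ha t ht)]
    exact le_max_left _ _
  · refine norm_cfcₙ_le fun t ht => ?_
    have ht0 := quasispectrum_nonneg_of_nonneg a ha t ht
    rw [Real.norm_of_nonneg (by simp only [hh]; positivity), hh, div_le_iff₀ (pow_pos (hm t) 2),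
      inv_mul_eq_div, le_div_iff₀ hδ, sq]
    exact mul_le_mul (le_max_left _ _) (le_max_right _ _) hδ.le (hm t).le
  · rw [cut, ← cfcₙ_mul _ _ a (continuous_max_sub δ).continuousOn (max_zero_sub hδ.le)
      (by fun_prop) (by simp)]
    congr 1
    funext t
    rcases le_total t δ with h | h
    · rw [max_eq_right (sub_nonpos.2 h), zero_mul]
    · have : 0 < t := hδ.trans_le h
      simp only [hh, max_eq_left h]
      field_simp

/-- Almost algebraic order at the level of elements. -/
theorem exists_almost_complement {a b c : D} (ha : 0 ≤ a) (hb : 0 ≤ b) (hc : 0 ≤ c)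
    (hab : a * b = 0) (h : CuntzBelow (a + b) c) {ε : ℝ} (hε : 0 < ε) :
    ∃ p d e : D, 0 ≤ p ∧ 0 ≤ d ∧ 0 ≤ e ∧ p * d = 0 ∧ CuntzBelow (cut ε a) p ∧
      CuntzBelow (cut ε b) d ∧ CuntzBelow (p + d) c ∧ CuntzBelow e a ∧ CuntzBelow c (e + d) := by
  have has := ha.isSelfAdjoint.star_eq
  have hbs := hb.isSelfAdjoint.star_eq
  have hba : b * a = 0 := by
    have := congrArg star hab
    rwa [star_mul, has, hbs, star_zero] at this
  have cube : ∀ {x : D}, 0 ≤ x → 0 ≤ x * x * x := fun {x} hx => by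
    have := nonneg_conjugate hx x
    rwa [hx.isSelfAdjoint.star_eq] at this
  obtain ⟨δ₁, hδ₁, hcut₁⟩ := (cuntzBelow_cube ha).exists_cut ha (cube ha) hε
  obtain ⟨δ₂, hδ₂, hcut₂⟩ := (cuntzBelow_cube hb).exists_cut hb (cube hb) hε
  set s := a + b with hs
  set K := ‖s‖ + 1 with hK
  have hK0 : 0 ≤ K := by positivity
  obtain ⟨δ, hδ, hδK⟩ := exists_pos_mul_lt_of_nonneg hK0 (half_pos hδ₁)
  obtain ⟨κ₀, hκ₀, hκ₀'⟩ := exists_pos_mul_lt_of_nonneg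
    (K := 2 * K * ‖a‖ + 2 * K * ‖b‖ + K * (3 * (δ⁻¹ * (K * ‖a‖ * ‖b‖)))) (by positivity)
    (ε := min (δ₁ / 2) δ₂) (by positivity)
  set κ := min κ₀ 1 with hκ
  have hκ0 : 0 < κ := by positivity
  have hκ1 : κ ≤ 1 := min_le_right _ _
  have hκ' : (2 * K * ‖a‖ + 2 * K * ‖b‖ + K * (3 * (δ⁻¹ * (K * ‖a‖ * ‖b‖)))) * κ ≤
      min (δ₁ / 2) δ₂ :=
    (mul_le_mul_of_nonneg_left (min_le_left _ _) (by positivity)).trans hκ₀'.le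
  have hκA : 2 * K * ‖a‖ * κ ≤ δ₁ / 2 := by
    refine le_trans ?_ (hκ'.trans (min_le_left _ _))
    gcongr
    have h1 : 0 ≤ 2 * K * ‖b‖ := by positivity
    have h2 : 0 ≤ K * (3 * (δ⁻¹ * (K * ‖a‖ * ‖b‖))) := by positivity
    linarith
  have hκB : 2 * K * ‖b‖ * κ + K * (3 * (δ⁻¹ * (K * ‖a‖ * ‖b‖ * κ))) ≤ δ₂ := by
    refine le_trans ?_ (hκ'.trans (min_le_right _ _))
    have h1 : 0 ≤ 2 * K * ‖a‖ * κ := by positivity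
    linarith
  obtain ⟨r, hr⟩ := cuntzBelow_iff.1 h κ hκ0
  obtain ⟨g, hg, -, hgg⟩ := exists_sqrt hc
  set w := r * g with hw
  set t := w * star w with ht
  have htr : t = r * c * star r := by
    rw [ht, hw, star_mul, hg, ← hgg]; simp only [mul_assoc]
  have hst : ‖s - t‖ ≤ κ := by rw [htr]; exact hr.le
  have hsK : ‖s‖ ≤ K := by rw [hK]; linarith
  have htK : ‖t‖ ≤ K := by
    have : t = s - (s - t) := by abel
    rw [this]
    exact (norm_sub_le _ _).trans (by linarith)
  have hwK : ‖w‖ ^ 2 ≤ K := by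
    rw [sq, ← CStarRing.norm_self_mul_star]; exact htK
  set a₁ := star w * a * w with ha₁
  set b₁ := star w * b * w with hb₁
  have ha₁0 : 0 ≤ a₁ := star_left_conjugate_nonneg ha w
  have hb₁0 : 0 ≤ b₁ := star_left_conjugate_nonneg hb w
  have hab₁ : ‖a₁ * b₁‖ ≤ K * ‖a‖ * ‖b‖ * κ := by
    have e : a₁ * b₁ = star w * (a * (t - s) * b) * star (star w) := by
      have : a * s * b = 0 := by
        rw [hs, mul_add, hab, add_zero, mul_assoc, hab, mul_zero]
      rw [mul_sub, sub_mul, this, sub_zero, star_star, ha₁, hb₁, ht]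
      simp only [mul_assoc]
    rw [e]
    refine (norm_conjugate_le _ _).trans ?_
    rw [norm_star]
    have : ‖a * (t - s) * b‖ ≤ ‖a‖ * κ * ‖b‖ := by
      refine (norm_mul_le _ _).trans ?_
      gcongr
      refine (norm_mul_le _ _).trans ?_
      gcongr
      rwa [norm_sub_rev]
    calc ‖w‖ ^ 2 * ‖a * (t - s) * b‖ ≤ K * (‖a‖ * κ * ‖b‖) := by gcongr
      _ = _ := by ring
  obtain ⟨H, e, hes, heH, hen, hHn, hpe⟩ := exists_unit_cut ha₁0 hδ
  set p := cut δ a₁ with hp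
  have hp0 : 0 ≤ p := cut_nonneg _ _
  set v := g - g * e with hv
  have hgl := sqrt_mem_leftIdeal hg hgg
  have he : e = (H * star w * a * r) * g := by
    rw [heH, ha₁, hw]; simp only [mul_assoc]
  have hpl : p ∈ leftIdeal c := by
    rw [← hpe, he, ← mul_assoc]
    exact mul_mem_leftIdeal _ hgl
  have hvl : v ∈ leftIdeal c := by
    refine sub_mem_leftIdeal hgl ?_
    rw [he, ← mul_assoc]
    exact mul_mem_leftIdeal _ hgl
  have hpd : p * (star v * v) = 0 := by
    have h1 : p * star v = 0 := by
      rw [hv, star_sub, star_mul, hes, hg, mul_sub, ← mul_assoc, hpe, sub_self]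
    rw [← mul_assoc, h1, zero_mul]
  refine ⟨p, star v * v, star (g * e) * (g * e), hp0, star_mul_self_nonneg v,
    star_mul_self_nonneg _, hpd, ?_, ?_, ?_, ?_, ?_⟩
  · refine hcut₁.trans ((cut_cuntzBelow_of_norm_sub_le (cube ha)
      (nonneg_conjugate hp0 w) ?_).trans (cuntzBelow_conjugate w p))
    have e2 : a * a * a - w * p * star w =
        (s * a * s - t * a * t) + w * (a₁ - p) * star w := by
      have h1 : s * a * s = a * a * a := by
        rw [hs, add_mul, hba, add_zero, mul_add, mul_assoc a a b, hab, mul_zero, add_zero]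
      have h2 : t * a * t = w * a₁ * star w := by
        rw [ht, ha₁]; simp only [mul_assoc]
      rw [h1, h2, mul_sub, sub_mul]; abel
    have h3 := norm_conj_sub_le (a := a) hsK htK hst
    have h4 := norm_conjugate_le w (a₁ - p)
    have h5 : ‖w‖ ^ 2 * ‖a₁ - p‖ ≤ K * δ := by
      gcongr; exact norm_sub_cut_le ha₁0 hδ.le
    rw [e2]
    exact (norm_add_le _ _).trans (by linarith)
  · set b₂ := star v * (star r * b * r) * v with hb₂
    have hb₂0 : 0 ≤ b₂ := star_left_conjugate_nonneg (star_left_conjugate_nonneg hb r) v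
    have hb₂d : CuntzBelow b₂ (star v * v) :=
      CuntzBelow.of_mem_leftIdeal hb₂0 (star_mul_self_nonneg v)
        (mul_mem_leftIdeal _ (mem_leftIdeal_of_star_mul_self_le le_rfl))
    refine hcut₂.trans ((cut_cuntzBelow_of_norm_sub_le (cube hb)
      (nonneg_conjugate hb₂0 w) ?_).trans ((cuntzBelow_conjugate w b₂).trans hb₂d))
    have e2 : b * b * b - w * b₂ * star w =
        (s * b * s - t * b * t) + w * (b₁ - b₂) * star w := by
      have h1 : s * b * s = b * b * b := by
        rw [hs, add_mul, hab, zero_add, mul_add, mul_assoc b b a, hba, mul_zero, zero_add]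
      have h2 : t * b * t = w * b₁ * star w := by
        rw [ht, hb₁]; simp only [mul_assoc]
      rw [h1, h2, mul_sub, sub_mul]; abel
    have h3 := norm_conj_sub_le (a := b) hsK htK hst
    have h4 := norm_conjugate_le w (b₁ - b₂)
    have heb : ‖e * b₁‖ ≤ δ⁻¹ * (K * ‖a‖ * ‖b‖ * κ) := by
      rw [heH, mul_assoc]
      refine (norm_mul_le _ _).trans ?_
      gcongr
    have hbe : ‖b₁ * e‖ ≤ δ⁻¹ * (K * ‖a‖ * ‖b‖ * κ) := by
      have : b₁ * e = star (e * b₁) := by rw [star_mul, hes, hb₁0.isSelfAdjoint.star_eq]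
      rwa [this, norm_star]
    have hebe : ‖e * b₁ * e‖ ≤ δ⁻¹ * (K * ‖a‖ * ‖b‖ * κ) :=
      (norm_mul_le _ _).trans (by nlinarith [norm_nonneg (e * b₁), norm_nonneg e])
    have e3 : b₁ - b₂ = e * b₁ + b₁ * e - e * b₁ * e := by
      rw [hb₂, hb₁, hv, hw]
      simp only [star_sub, star_mul, hes, hg, sub_mul, mul_sub, mul_assoc]
      abel
    have h6 : ‖b₁ - b₂‖ ≤ 3 * (δ⁻¹ * (K * ‖a‖ * ‖b‖ * κ)) := by
      rw [e3]
      have := norm_sub_le (e * b₁ + b₁ * e) (e * b₁ * e)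
      have := norm_add_le (e * b₁) (b₁ * e)
      linarith
    have h5 : ‖w‖ ^ 2 * ‖b₁ - b₂‖ ≤ K * (3 * (δ⁻¹ * (K * ‖a‖ * ‖b‖ * κ))) := by gcongr
    rw [e2]
    exact (norm_add_le _ _).trans (by linarith)
  · exact CuntzBelow.of_mem_leftIdeal (add_nonneg hp0 (star_mul_self_nonneg v)) hc
      (add_mem_leftIdeal hpl (mul_mem_leftIdeal _ hvl))
  · refine (CuntzBelow.of_mem_leftIdeal (star_mul_self_nonneg _) ha₁0 ?_).trans ?_
    · have e2 : star (g * e) * (g * e) = (star (g * e) * g * H) * a₁ := by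
        conv_lhs => rw [heH]
        rw [heH]
        simp only [mul_assoc]
      rw [e2]
      exact mul_mem_leftIdeal _ (self_mem_leftIdeal ha₁0)
    · have := cuntzBelow_conjugate (star w) a
      rwa [star_star] at this
  · refine CuntzBelow.of_le_smul hc (c := 2) two_pos ?_
    rw [← sub_nonneg]
    have e2 : (2 : ℝ) • (star (g * e) * (g * e) + star v * v) - c =
        star (g * e - v) * (g * e - v) := by
      have h1 : c = star (g * e + v) * (g * e + v) := by
        have : g * e + v = g := by rw [hv]; abel
        rw [this, hg, hgg]
      rw [h1, two_smul]
      simp only [star_add, star_sub, add_mul, mul_add, sub_mul, mul_sub]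
      abel
    rw [e2]
    exact star_mul_self_nonneg _

/-- Two elements below `a` are almost dominated by an element below `a` and below their sum. -/
theorem exists_almost_join {a a₁ a₂ : D} (ha : 0 ≤ a) (ha₁ : 0 ≤ a₁) (ha₂ : 0 ≤ a₂)
    (h₁ : CuntzBelow a₁ a) (h₂ : CuntzBelow a₂ a) {ε : ℝ} (hε : 0 < ε) :
    ∃ m₁ m₂ : D, 0 ≤ m₁ ∧ 0 ≤ m₂ ∧ CuntzBelow m₁ a₁ ∧ CuntzBelow m₂ a₂ ∧
      CuntzBelow (cut ε a₁) m₁ ∧ CuntzBelow (cut ε a₂) m₂ ∧ CuntzBelow (m₁ + m₂) a := by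
  obtain ⟨g, hg, -, hgg⟩ := exists_sqrt ha
  have key : ∀ {x : D}, 0 ≤ x → CuntzBelow x a → ∃ m, 0 ≤ m ∧ CuntzBelow m x ∧
      CuntzBelow (cut ε x) m ∧ m ∈ leftIdeal a := by
    intro x hx hxa
    obtain ⟨r, hr1, hr2⟩ := hxa.exists_conjugate hx ha hε
    have e : r * a * star r = (r * g) * star (r * g) := by
      rw [star_mul, hg, ← hgg]; simp only [mul_assoc]
    rw [e] at hr1 hr2
    refine ⟨star (r * g) * (r * g), star_mul_self_nonneg _,
      (star_mul_cuntzBelow_mul_star _).trans hr1, hr2.trans (mul_star_cuntzBelow_star_mul _), ?_⟩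
    rw [← mul_assoc]
    exact mul_mem_leftIdeal _ (sqrt_mem_leftIdeal hg hgg)
  obtain ⟨m₁, p1, p2, p3, p4⟩ := key ha₁ h₁
  obtain ⟨m₂, q1, q2, q3, q4⟩ := key ha₂ h₂
  exact ⟨m₁, m₂, p1, q1, p2, q2, p3, q3,
    CuntzBelow.of_mem_leftIdeal (add_nonneg p1 q1) ha (add_mem_leftIdeal p4 q4)⟩

end Riesz

/-- A C*-algebra with a chosen sequence of isometric left multiplications with orthogonal ranges. -/
class HasShifts (D : Type*) [NonUnitalCStarAlgebra D] where
  shift : ℕ → D → D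
  isShiftSystem : IsShiftSystem shift

section CuClass

variable (D : Type*) [NonUnitalCStarAlgebra D] [PartialOrder D] [StarOrderedRing D]

/-- The positive elements, preordered by Cuntz subequivalence. -/
structure PosElt where
  val : D
  nonneg : 0 ≤ val

instance : Preorder (PosElt D) where
  le a b := CuntzBelow a.val b.val
  le_refl a := CuntzBelow.refl a.2
  le_trans _ _ _ h₁ h₂ := h₁.trans h₂

/-- The set of Cuntz classes of positive elements of `D`. -/
abbrev CuClass := Antisymmetrization (PosElt D) (· ≤ ·)

variable {D}

open Classical in
/-- The Cuntz class of a positive element (and `0` for other elements). -/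
noncomputable def cuCls (a : D) : CuClass D :=
  toAntisymmetrization _ (if h : 0 ≤ a then (⟨a, h⟩ : PosElt D) else ⟨0, le_rfl⟩)

theorem cuCls_le_iff {a b : D} (ha : 0 ≤ a) (hb : 0 ≤ b) : cuCls a ≤ cuCls b ↔ CuntzBelow a b := by
  rw [cuCls, cuCls, dif_pos ha, dif_pos hb, toAntisymmetrization_le_toAntisymmetrization_iff]
  rfl

theorem exists_cuCls (x : CuClass D) : ∃ a : D, 0 ≤ a ∧ cuCls a = x := by
  induction x using Antisymmetrization.ind with
  | _ a => exact ⟨a.1, a.2, by rw [cuCls, dif_pos a.2]⟩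

theorem cuCls_congr {a b : D} (ha : 0 ≤ a) (hb : 0 ≤ b) (h₁ : CuntzBelow a b)
    (h₂ : CuntzBelow b a) : cuCls a = cuCls b :=
  le_antisymm ((cuCls_le_iff ha hb).2 h₁) ((cuCls_le_iff hb ha).2 h₂)

/-- A representative of a Cuntz class. -/
noncomputable def rep (x : CuClass D) : D := (exists_cuCls x).choose

theorem rep_nonneg (x : CuClass D) : 0 ≤ rep x := (exists_cuCls x).choose_spec.1

theorem cuCls_rep (x : CuClass D) : cuCls (rep x) = x := (exists_cuCls x).choose_spec.2

theorem mul_eq_zero_comm_of_nonneg {a b : D} (ha : 0 ≤ a) (hb : 0 ≤ b) (h : a * b = 0) :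
    b * a = 0 := by
  have := congrArg star h
  rwa [star_mul, ha.isSelfAdjoint.star_eq, hb.isSelfAdjoint.star_eq, star_zero] at this

theorem mem_leftIdeal_of_le {z a : D} (hz : 0 ≤ z) (h : z ≤ a) : z ∈ leftIdeal a := by
  obtain ⟨g, hg, -, hgg⟩ := exists_sqrt hz
  have := mul_mem_leftIdeal g (mem_leftIdeal_of_star_mul_self_le (z := g) (y := a)
    (by rwa [hg, hgg]))
  rwa [hgg] at this

theorem cut_mul_cut_eq_zero {a b : D} (ha : 0 ≤ a) (hb : 0 ≤ b) (h : a * b = 0) {ε δ : ℝ}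
    (hε : 0 ≤ ε) (hδ : 0 ≤ δ) : cut ε a * cut δ b = 0 := by
  have h1 := mul_eq_zero_of_mem_leftIdeal
    (mem_leftIdeal_of_le (cut_nonneg ε a) (cut_le_self ha hε)) h
  have h2 := mul_eq_zero_comm_of_nonneg (cut_nonneg ε a) hb h1
  exact mul_eq_zero_comm_of_nonneg (cut_nonneg δ b) (cut_nonneg ε a)
    (mul_eq_zero_of_mem_leftIdeal (mem_leftIdeal_of_le (cut_nonneg δ b) (cut_le_self hb hδ)) h2)

theorem cut_cuntzBelow_cut_cut {a : D} (ha : 0 ≤ a) {ε δ κ : ℝ} (hδ : 0 ≤ δ) (hκ : 0 ≤ κ)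
    (h : δ + κ ≤ ε) : CuntzBelow (cut ε a) (cut δ (cut κ a)) := by
  refine cut_cuntzBelow_of_norm_sub_le ha (cut_nonneg _ _) ?_
  have e : a - cut δ (cut κ a) = (a - cut κ a) + (cut κ a - cut δ (cut κ a)) := by abel
  rw [e]
  refine (norm_add_le _ _).trans ?_
  linarith [norm_sub_cut_le ha hκ, norm_sub_cut_le (cut_nonneg κ a) hδ]

theorem monotone_cuCls_cut (a : D) : Monotone fun n : ℕ => cuCls (cut (1 / ((n : ℝ) + 1)) a) :=
  fun n m h => (cuCls_le_iff (cut_nonneg _ _) (cut_nonneg _ _)).2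
    (CuntzBelow.of_le (cut_nonneg _ _) (cut_anti (by positivity) (by gcongr)))

theorem isLUB_cuCls_cut {a : D} (ha : 0 ≤ a) :
    IsLUB (Set.range fun n : ℕ => cuCls (cut (1 / ((n : ℝ) + 1)) a)) (cuCls a) := by
  constructor
  · rintro _ ⟨n, rfl⟩
    exact (cuCls_le_iff (cut_nonneg _ _) ha).2 (cut_cuntzBelow ha (by positivity))
  · intro y hy
    obtain ⟨b, hb, rfl⟩ := exists_cuCls y
    refine (cuCls_le_iff ha hb).2 (cuntzBelow_of_forall_cut ha fun ε hε => ?_)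
    obtain ⟨n, hn⟩ := exists_nat_one_div_lt hε
    exact (CuntzBelow.of_le (cut_nonneg _ _) (cut_anti (by positivity) hn.le)).trans
      ((cuCls_le_iff (cut_nonneg _ _) hb).1 (hy ⟨n, rfl⟩))

noncomputable instance : Zero (CuClass D) := ⟨cuCls 0⟩

theorem CuClass.zero_le (x : CuClass D) : 0 ≤ x := by
  obtain ⟨a, ha, rfl⟩ := exists_cuCls x
  exact (cuCls_le_iff le_rfl ha).2 (CuntzBelow.of_le le_rfl ha)

theorem _root_.WayBelow.le {P : Type*} [PartialOrder P] {x y : P} (h : WayBelow x y) : x ≤ y := by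
  obtain ⟨n, hn⟩ := h (fun _ => y) monotone_const y (by simp) le_rfl
  exact hn

theorem _root_.WayBelow.mono {P : Type*} [PartialOrder P] {x x' y y' : P} (h : WayBelow x y)
    (hx : x' ≤ x) (hy : y ≤ y') : WayBelow x' y' := fun f hf s hs hys =>
  (h f hf s hs (hy.trans hys)).imp fun _ hn => hx.trans hn

variable [HasShifts D]

/-- A copy of a positive element under the `i`-th corner. -/
noncomputable def amp (i : ℕ) (a : D) : D :=
  HasShifts.shift i (CFC.sqrt a) * star (HasShifts.shift i (CFC.sqrt a))

theorem amp_nonneg (i : ℕ) (a : D) : 0 ≤ amp i a := mul_star_self_nonneg _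

theorem cuCls_amp (i : ℕ) {a : D} (ha : 0 ≤ a) : cuCls (amp i a) = cuCls a := by
  have h1 : star (HasShifts.shift i (CFC.sqrt a)) * HasShifts.shift i (CFC.sqrt a) = a := by
    rw [HasShifts.isShiftSystem.star_mul_self, (CFC.sqrt_nonneg a).isSelfAdjoint.star_eq,
      CFC.sqrt_mul_sqrt_self a ha]
  have h2 := star_mul_cuntzBelow_mul_star (HasShifts.shift i (CFC.sqrt a))
  have h3 := mul_star_cuntzBelow_star_mul (HasShifts.shift i (CFC.sqrt a))
  rw [h1] at h2 h3
  exact cuCls_congr (amp_nonneg i a) ha h3 h2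

theorem amp_mul_amp {i j : ℕ} (h : i ≠ j) (a b : D) : amp i a * amp j b = 0 := by
  rw [amp, amp, mul_assoc, ← mul_assoc (star _), HasShifts.isShiftSystem.star_mul_of_ne h,
    zero_mul, mul_zero]

theorem exists_cuCls_amp (i : ℕ) (x : CuClass D) :
    ∃ a : D, 0 ≤ a ∧ cuCls a = x ∧ a = amp i (rep x) :=
  ⟨_, amp_nonneg i _, (cuCls_amp i (rep_nonneg x)).trans (cuCls_rep x), rfl⟩

noncomputable instance : Add (CuClass D) := ⟨fun x y => cuCls (amp 0 (rep x) + amp 1 (rep y))⟩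

theorem cuCls_add_le {a b : D} (ha : 0 ≤ a) (hb : 0 ≤ b) :
    cuCls (a + b) ≤ cuCls a + cuCls b := by
  obtain ⟨a', ha', h1, e1⟩ := exists_cuCls_amp 0 (cuCls a)
  obtain ⟨b', hb', h2, e2⟩ := exists_cuCls_amp 1 (cuCls b)
  change _ ≤ cuCls (amp 0 (rep (cuCls a)) + amp 1 (rep (cuCls b)))
  rw [← e1, ← e2, cuCls_le_iff (add_nonneg ha hb) (add_nonneg ha' hb')]
  exact add_cuntzBelow_add ha' hb' (by rw [e1, e2]; exact amp_mul_amp zero_ne_one _ _)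
    ((cuCls_le_iff ha ha').1 h1.ge) ((cuCls_le_iff hb hb').1 h2.ge)

theorem cuCls_add {a b : D} (ha : 0 ≤ a) (hb : 0 ≤ b) (h : a * b = 0) :
    cuCls (a + b) = cuCls a + cuCls b := by
  refine le_antisymm (cuCls_add_le ha hb) ?_
  obtain ⟨a', ha', h1, e1⟩ := exists_cuCls_amp 0 (cuCls a)
  obtain ⟨b', hb', h2, e2⟩ := exists_cuCls_amp 1 (cuCls b)
  change cuCls (amp 0 (rep (cuCls a)) + amp 1 (rep (cuCls b))) ≤ _
  rw [← e1, ← e2, cuCls_le_iff (add_nonneg ha' hb') (add_nonneg ha hb)]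
  exact add_cuntzBelow_add ha hb h ((cuCls_le_iff ha' ha).1 h1.le) ((cuCls_le_iff hb' hb).1 h2.le)

theorem exists_orth_pair (x y : CuClass D) :
    ∃ a b : D, 0 ≤ a ∧ 0 ≤ b ∧ a * b = 0 ∧ cuCls a = x ∧ cuCls b = y := by
  obtain ⟨a, ha, h1, e1⟩ := exists_cuCls_amp 0 x
  obtain ⟨b, hb, h2, e2⟩ := exists_cuCls_amp 1 y
  exact ⟨a, b, ha, hb, by rw [e1, e2]; exact amp_mul_amp zero_ne_one _ _, h1, h2⟩

theorem CuClass.add_mono {x y z w : CuClass D} (h₁ : x ≤ y) (h₂ : z ≤ w) : x + z ≤ y + w := by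
  obtain ⟨a, b, ha, hb, hab, rfl, rfl⟩ := exists_orth_pair x z
  obtain ⟨c, d, hc, hd, hcd, rfl, rfl⟩ := exists_orth_pair y w
  rw [← cuCls_add ha hb hab, ← cuCls_add hc hd hcd,
    cuCls_le_iff (add_nonneg ha hb) (add_nonneg hc hd)]
  exact add_cuntzBelow_add hc hd hcd ((cuCls_le_iff ha hc).1 h₁) ((cuCls_le_iff hb hd).1 h₂)

theorem CuClass.add_comm' (x y : CuClass D) : x + y = y + x := by
  obtain ⟨a, b, ha, hb, hab, rfl, rfl⟩ := exists_orth_pair x y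
  rw [← cuCls_add ha hb hab, ← cuCls_add hb ha (mul_eq_zero_comm_of_nonneg ha hb hab), add_comm]

theorem CuClass.zero_add' (x : CuClass D) : 0 + x = x := by
  obtain ⟨a, ha, rfl⟩ := exists_cuCls x
  change cuCls 0 + cuCls a = cuCls a
  rw [← cuCls_add le_rfl ha (zero_mul a), zero_add]

noncomputable instance : AddCommMonoid (CuClass D) where
  add_assoc x y z := by
    obtain ⟨a, ha, h1, e1⟩ := exists_cuCls_amp 0 x
    obtain ⟨b, hb, h2, e2⟩ := exists_cuCls_amp 1 y
    obtain ⟨c, hc, h3, e3⟩ := exists_cuCls_amp 2 z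
    have hab : a * b = 0 := by rw [e1, e2]; exact amp_mul_amp (by norm_num) _ _
    have hac : a * c = 0 := by rw [e1, e3]; exact amp_mul_amp (by norm_num) _ _
    have hbc : b * c = 0 := by rw [e2, e3]; exact amp_mul_amp (by norm_num) _ _
    rw [← h1, ← h2, ← h3, ← cuCls_add ha hb hab, ← cuCls_add hb hc hbc,
      ← cuCls_add (add_nonneg ha hb) hc (by rw [add_mul, hac, hbc, add_zero]),
      ← cuCls_add ha (add_nonneg hb hc) (by rw [mul_add, hab, hac, add_zero]), add_assoc]
  zero_add := CuClass.zero_add'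
  add_zero x := by rw [CuClass.add_comm', CuClass.zero_add']
  add_comm := CuClass.add_comm'
  nsmul := nsmulRec

theorem exists_isLUB_cuCls {f : ℕ → CuClass D} (hf : Monotone f) :
    ∃ a : D, 0 ≤ a ∧ IsLUB (Set.range f) (cuCls a) ∧
      ∀ δ : ℝ, 0 < δ → ∃ n, cuCls (cut δ a) ≤ f n := by
  choose b hb hbf using fun n => exists_cuCls (f n)
  obtain ⟨a, ha, h1, h2⟩ := exists_sup (HasShifts.isShiftSystem (D := D)) hb
    (fun n m h => (cuCls_le_iff (hb n) (hb m)).1 (by rw [hbf, hbf]; exact hf h))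
  refine ⟨a, ha, ⟨?_, fun y hy => ?_⟩, fun δ hδ => ?_⟩
  · rintro _ ⟨n, rfl⟩
    rw [← hbf]
    exact (cuCls_le_iff (hb n) ha).2 (h1 n)
  · obtain ⟨d, hd, rfl⟩ := exists_cuCls y
    refine (cuCls_le_iff ha hd).2 (cuntzBelow_of_forall_cut ha fun δ hδ => ?_)
    obtain ⟨n, hn⟩ := h2 δ hδ
    exact hn.trans ((cuCls_le_iff (hb n) hd).1 (by rw [hbf]; exact hy ⟨n, rfl⟩))
  · obtain ⟨n, hn⟩ := h2 δ hδ
    refine ⟨n, ?_⟩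
    rw [← hbf]
    exact (cuCls_le_iff (cut_nonneg _ _) (hb n)).2 hn

theorem wayBelow_cuCls_iff {x : CuClass D} {a : D} (ha : 0 ≤ a) :
    WayBelow x (cuCls a) ↔ ∃ ε : ℝ, 0 < ε ∧ x ≤ cuCls (cut ε a) := by
  constructor
  · intro h
    obtain ⟨n, hn⟩ := h _ (monotone_cuCls_cut a) _ (isLUB_cuCls_cut ha) le_rfl
    exact ⟨_, by positivity, hn⟩
  · rintro ⟨ε, hε, hx⟩ f hf s hs has
    obtain ⟨b, hb, hlub, hcut⟩ := exists_isLUB_cuCls hf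
    rw [hs.unique hlub, cuCls_le_iff ha hb] at has
    obtain ⟨δ, hδ, h1⟩ := has.exists_cut ha hb hε
    obtain ⟨n, hn⟩ := hcut δ hδ
    exact ⟨n, hx.trans (((cuCls_le_iff (cut_nonneg _ _) (cut_nonneg _ _)).2 h1).trans hn)⟩

theorem CuClass.exists_waybelow_seq' (x : CuClass D) : ∃ f : ℕ → CuClass D, Monotone f ∧
    (∀ n, WayBelow (f n) (f (n + 1))) ∧ IsLUB (Set.range f) x := by
  obtain ⟨a, ha, rfl⟩ := exists_cuCls x
  refine ⟨_, monotone_cuCls_cut a, fun n => ?_, isLUB_cuCls_cut ha⟩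
  rw [wayBelow_cuCls_iff (cut_nonneg _ _)]
  have h : 1 / (((n + 1 : ℕ) : ℝ) + 1) < 1 / ((n : ℝ) + 1) := by
    push_cast
    gcongr
    linarith
  exact ⟨_, sub_pos.2 h, (cuCls_le_iff (cut_nonneg _ _) (cut_nonneg _ _)).2
    (cut_cuntzBelow_cut_cut ha (sub_pos.2 h).le (by positivity) (by linarith))⟩

theorem CuClass.waybelow_add' {x y z w : CuClass D} (h₁ : WayBelow x y) (h₂ : WayBelow z w) :
    WayBelow (x + z) (y + w) := by
  obtain ⟨a, b, ha, hb, hab, rfl, rfl⟩ := exists_orth_pair y w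
  obtain ⟨ε, hε, hx⟩ := (wayBelow_cuCls_iff ha).1 h₁
  obtain ⟨δ, hδ, hz⟩ := (wayBelow_cuCls_iff hb).1 h₂
  have hκ : 0 < min ε δ := lt_min hε hδ
  rw [← cuCls_add ha hb hab, wayBelow_cuCls_iff (add_nonneg ha hb)]
  refine ⟨min ε δ, hκ, (CuClass.add_mono hx hz).trans ?_⟩
  rw [← cuCls_add (cut_nonneg _ _) (cut_nonneg _ _) (cut_mul_cut_eq_zero ha hb hab hε.le hδ.le),
    cuCls_le_iff (add_nonneg (cut_nonneg _ _) (cut_nonneg _ _)) (cut_nonneg _ _)]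
  refine (CuntzBelow.of_le (add_nonneg (cut_nonneg _ _) (cut_nonneg _ _)) (add_le_add
    (cut_anti hκ.le (min_le_left _ _)) (cut_anti hκ.le (min_le_right _ _)))).trans ?_
  exact cut_add_cut_cuntzBelow ha hb (cut_nonneg _ _) hab hκ.le
    (norm_sub_cut_le (add_nonneg ha hb) hκ.le)

theorem CuClass.almost_algebraic' {x' x y' y z : CuClass D} (hx : WayBelow x' x)
    (hy : WayBelow y' y) (h : x + y ≤ z) : ∃ c, y' ≤ c ∧ x' + c ≤ z ∧ z ≤ x + c := by
  obtain ⟨a, b, ha, hb, hab, rfl, rfl⟩ := exists_orth_pair x y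
  obtain ⟨c, hc, rfl⟩ := exists_cuCls z
  obtain ⟨ε, hε, hx⟩ := (wayBelow_cuCls_iff ha).1 hx
  obtain ⟨δ, hδ, hy⟩ := (wayBelow_cuCls_iff hb).1 hy
  have hκ : 0 < min ε δ := lt_min hε hδ
  rw [← cuCls_add ha hb hab, cuCls_le_iff (add_nonneg ha hb) hc] at h
  obtain ⟨p, d, e, hp, hd, he, hpd, h1, h2, h3, h4, h5⟩ :=
    exists_almost_complement ha hb hc hab h hκ
  refine ⟨cuCls d, hy.trans ?_, ?_, ?_⟩
  · refine (cuCls_le_iff (cut_nonneg _ _) hd).2 (CuntzBelow.trans ?_ h2)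
    exact CuntzBelow.of_le (cut_nonneg _ _) (cut_anti hκ.le (min_le_right _ _))
  · have h6 : x' ≤ cuCls p := hx.trans ((cuCls_le_iff (cut_nonneg _ _) hp).2
      ((CuntzBelow.of_le (cut_nonneg _ _) (cut_anti hκ.le (min_le_left _ _))).trans h1))
    refine (CuClass.add_mono h6 le_rfl).trans ?_
    rw [← cuCls_add hp hd hpd]
    exact (cuCls_le_iff (add_nonneg hp hd) hc).2 h3
  · exact ((cuCls_le_iff hc (add_nonneg he hd)).2 h5).trans ((cuCls_add_le he hd).trans
      (CuClass.add_mono ((cuCls_le_iff he ha).2 h4) le_rfl))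

theorem CuClass.almost_riesz' {x' x y z : CuClass D} (hx : WayBelow x' x) (h : x ≤ y + z) :
    ∃ v w : CuClass D, v ≤ x ∧ v ≤ y ∧ w ≤ x ∧ w ≤ z ∧ x' ≤ v + w := by
  obtain ⟨b, c, hb, hc, hbc, rfl, rfl⟩ := exists_orth_pair y z
  obtain ⟨a, ha, rfl⟩ := exists_cuCls x
  obtain ⟨ε, hε, hx⟩ := (wayBelow_cuCls_iff ha).1 hx
  have hbc0 := add_nonneg hb hc
  rw [← cuCls_add hb hc hbc, cuCls_le_iff ha hbc0] at h
  obtain ⟨r, h1, h2⟩ := h.exists_conjugate ha hbc0 hε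
  have hb' := nonneg_conjugate hb r
  have hc' := nonneg_conjugate hc r
  have e : r * (b + c) * star r = r * b * star r + r * c * star r := by rw [mul_add, add_mul]
  rw [e] at h1 h2
  refine ⟨cuCls (r * b * star r), cuCls (r * c * star r), (cuCls_le_iff hb' ha).2 ?_,
    (cuCls_le_iff hb' hb).2 (cuntzBelow_conjugate _ _), (cuCls_le_iff hc' ha).2 ?_,
    (cuCls_le_iff hc' hc).2 (cuntzBelow_conjugate _ _), ?_⟩
  · exact (CuntzBelow.of_le hb' (le_add_of_nonneg_right hc')).trans h1
  · exact (CuntzBelow.of_le hc' (le_add_of_nonneg_left hb')).trans h1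
  · exact hx.trans (((cuCls_le_iff (cut_nonneg _ _) (add_nonneg hb' hc')).2 h2).trans
      (cuCls_add_le hb' hc'))

theorem CuClass.exists_almost_join' {x z₁ z₂ z₁' z₂' : CuClass D} (h₁ : z₁ ≤ x) (h₂ : z₂ ≤ x)
    (h₁' : WayBelow z₁' z₁) (h₂' : WayBelow z₂' z₂) :
    ∃ z, z ≤ x ∧ z ≤ z₁ + z₂ ∧ z₁' ≤ z ∧ z₂' ≤ z := by
  obtain ⟨a, ha, rfl⟩ := exists_cuCls x
  obtain ⟨a₁, ha₁, rfl⟩ := exists_cuCls z₁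
  obtain ⟨a₂, ha₂, rfl⟩ := exists_cuCls z₂
  obtain ⟨ε, hε, hx⟩ := (wayBelow_cuCls_iff ha₁).1 h₁'
  obtain ⟨δ, hδ, hy⟩ := (wayBelow_cuCls_iff ha₂).1 h₂'
  have hκ : 0 < min ε δ := lt_min hε hδ
  obtain ⟨m₁, m₂, hm₁, hm₂, k1, k2, k3, k4, k5⟩ := exists_almost_join ha ha₁ ha₂
    ((cuCls_le_iff ha₁ ha).1 h₁) ((cuCls_le_iff ha₂ ha).1 h₂) hκ
  have hm := add_nonneg hm₁ hm₂
  refine ⟨cuCls (m₁ + m₂), (cuCls_le_iff hm ha).2 k5, (cuCls_add_le hm₁ hm₂).trans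
    (CuClass.add_mono ((cuCls_le_iff hm₁ ha₁).2 k1) ((cuCls_le_iff hm₂ ha₂).2 k2)),
    hx.trans ((cuCls_le_iff (cut_nonneg _ _) hm).2 ?_),
    hy.trans ((cuCls_le_iff (cut_nonneg _ _) hm).2 ?_)⟩
  · exact ((CuntzBelow.of_le (cut_nonneg _ _) (cut_anti hκ.le (min_le_left _ _))).trans k3).trans
      (CuntzBelow.of_le hm₁ (le_add_of_nonneg_right hm₂))
  · exact ((CuntzBelow.of_le (cut_nonneg _ _) (cut_anti hκ.le (min_le_right _ _))).trans k4).trans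
      (CuntzBelow.of_le hm₂ (le_add_of_nonneg_left hm₁))

theorem CuClass.exists_countable_basis [TopologicalSpace.SeparableSpace D] :
    ∃ t : ℕ → CuClass D, ∀ z' z : CuClass D, WayBelow z' z →
      ∃ n, z' ≤ t n ∧ WayBelow (t n) z := by
  set u := TopologicalSpace.denseSeq D with hu
  refine ⟨fun n => cuCls (cut (2 * (1 / ((n.unpair.2 : ℝ) + 1)))
    (star (u n.unpair.1) * u n.unpair.1)), fun z' z h => ?_⟩
  obtain ⟨a, ha, rfl⟩ := exists_cuCls z
  obtain ⟨ε, hε, hz⟩ := (wayBelow_cuCls_iff ha).1 h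
  obtain ⟨m, hm⟩ := exists_nat_one_div_lt (show (0 : ℝ) < ε / 3 by positivity)
  set η : ℝ := 1 / ((m : ℝ) + 1) with hη
  have hη0 : 0 < η := by positivity
  obtain ⟨c, rfl⟩ := CStarAlgebra.nonneg_iff_eq_star_mul_self.1 ha
  obtain ⟨k, hk⟩ := (TopologicalSpace.denseRange_denseSeq D).exists_mem_open
    (s := {d | ‖star c * c - star d * d‖ < η})
    (isOpen_lt (by fun_prop) continuous_const) ⟨c, by simpa using hη0⟩
  replace hk : ‖star c * c - star (u k) * u k‖ < η := hk
  refine ⟨Nat.pair k m, ?_, ?_⟩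
  · simp only [Nat.unpair_pair]
    refine hz.trans ((cuCls_le_iff (cut_nonneg _ _) (cut_nonneg _ _)).2 ?_)
    refine (CuntzBelow.of_le (cut_nonneg _ _) (cut_anti (ε := 3 * η) (by positivity)
      (by linarith))).trans (cut_cuntzBelow_of_norm_sub_le ha (cut_nonneg _ _) ?_)
    have h1 := norm_sub_cut_le (star_mul_self_nonneg (u k)) (ε := 2 * η) (by positivity)
    exact (norm_sub_le_norm_sub_add_norm_sub _ (star (u k) * u k) _).trans (by linarith)
  · simp only [Nat.unpair_pair]
    refine (wayBelow_cuCls_iff ha).2 ⟨η, hη0, (cuCls_le_iff (cut_nonneg _ _) (cut_nonneg _ _)).2 ?_⟩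
    refine cut_cuntzBelow_of_norm_sub_le (star_mul_self_nonneg _) (cut_nonneg _ _) ?_
    have h1 := norm_sub_cut_le ha hη0.le
    rw [norm_sub_rev] at hk
    exact (norm_sub_le_norm_sub_add_norm_sub _ (star c * c) _).trans (by linarith)

theorem CuClass.exists_isGLB [TopologicalSpace.SeparableSpace D] (x w : CuClass D)
    (hw : w + w ≤ w) : ∃ m, IsGLB {x, w} m := by
  obtain ⟨t, ht⟩ := CuClass.exists_countable_basis (D := D)
  set M : Set (CuClass D) := {z | z ≤ x ∧ z ≤ w} with hM
  have interp : ∀ {y z : CuClass D}, WayBelow y z → ∃ v, WayBelow y v ∧ WayBelow v z := by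
    intro y z h
    obtain ⟨f, hf, hf1, hf2⟩ := CuClass.exists_waybelow_seq' z
    obtain ⟨n, hn⟩ := h f hf z hf2 le_rfl
    exact ⟨f (n + 1), (hf1 n).mono hn le_rfl, (hf1 (n + 1)).mono le_rfl (hf2.1 ⟨_, rfl⟩)⟩
  have step : ∀ (n : ℕ) (u : CuClass D), (∃ z ∈ M, WayBelow u z) →
      ∃ u', (∃ z ∈ M, WayBelow u' z) ∧ (u ≤ u' ∧ ((∃ z ∈ M, WayBelow (t n) z) → t n ≤ u')) := by
    rintro n u ⟨z₁, hz₁, hu⟩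
    by_cases hn : ∃ z ∈ M, WayBelow (t n) z
    · obtain ⟨z₂, hz₂, ht2⟩ := hn
      obtain ⟨u₁, hu1, hu2⟩ := interp hu
      obtain ⟨t₁, ht1, ht2'⟩ := interp ht2
      obtain ⟨z, hzx, hz, h1, h2⟩ := CuClass.exists_almost_join' hz₁.1 hz₂.1 hu2 ht2'
      obtain ⟨f, hf, hf1, hf2⟩ := CuClass.exists_waybelow_seq' z
      obtain ⟨i, hi⟩ := hu1 f hf z hf2 h1
      obtain ⟨j, hj⟩ := ht1 f hf z hf2 h2
      exact ⟨f (max i j), ⟨z, ⟨hzx, hz.trans ((CuClass.add_mono hz₁.2 hz₂.2).trans hw)⟩,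
        (hf1 _).mono le_rfl (hf2.1 ⟨_, rfl⟩)⟩, hi.trans (hf (le_max_left _ _)),
        fun _ => hj.trans (hf (le_max_right _ _))⟩
    · exact ⟨u, ⟨z₁, hz₁, hu⟩, le_rfl, fun h => absurd h hn⟩
  have hzero : ∃ z ∈ M, WayBelow (0 : CuClass D) z :=
    ⟨0, ⟨CuClass.zero_le _, CuClass.zero_le _⟩, fun f _ _ _ _ => ⟨0, CuClass.zero_le _⟩⟩
  obtain ⟨u, hu, hu'⟩ := exists_dependent_seq _ _ ⟨0, hzero⟩ step
  have hum : Monotone u := monotone_nat_of_le_succ fun n => (hu' n).1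
  obtain ⟨a, ha, hlub, -⟩ := exists_isLUB_cuCls hum
  refine ⟨cuCls a, ?_, fun z hz => ?_⟩
  · have h1 : ∀ n, u n ≤ x ∧ u n ≤ w := fun n => by
      obtain ⟨z, hz, h⟩ := hu n
      exact ⟨(h.le).trans hz.1, (h.le).trans hz.2⟩
    rintro y (rfl | rfl)
    · exact hlub.2 (by rintro _ ⟨n, rfl⟩; exact (h1 n).1)
    · exact hlub.2 (by rintro _ ⟨n, rfl⟩; exact (h1 n).2)
  · have hzM : z ∈ M := ⟨hz (by simp), hz (by simp)⟩
    obtain ⟨f, hf, hf1, hf2⟩ := CuClass.exists_waybelow_seq' z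
    refine hf2.2 ?_
    rintro _ ⟨n, rfl⟩
    obtain ⟨k, hk1, hk2⟩ := ht (f n) z ((hf1 n).mono le_rfl (hf2.1 ⟨_, rfl⟩))
    exact hk1.trans (((hu' k).2 ⟨z, hzM, hk2⟩).trans (hlub.1 ⟨_, rfl⟩))

theorem CuClass.monotone_nsmul (y : CuClass D) : Monotone fun n : ℕ => n • y :=
  monotone_nat_of_le_succ fun n => by
    have := CuClass.add_mono (le_refl (n • y)) (CuClass.zero_le y)
    rwa [add_zero, ← succ_nsmul] at this

theorem CuClass.exists_infty (y : CuClass D) : ∃ w, IsLUB (Set.range fun n : ℕ => n • y) w ∧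
    w + w ≤ w := by
  obtain ⟨a, ha, hlub, -⟩ := exists_isLUB_cuCls (CuClass.monotone_nsmul y)
  refine ⟨cuCls a, hlub, ?_⟩
  obtain ⟨b, c, hb, hc, hbc, h1, h2⟩ := exists_orth_pair (cuCls a) (cuCls a)
  have key : ∀ {d : D}, 0 ≤ d → cuCls d = cuCls a → ∀ ε : ℝ, 0 < ε → ∃ n : ℕ,
      cuCls (cut ε d) ≤ n • y := fun hd h ε hε =>
    (wayBelow_cuCls_iff hd).2 ⟨ε, hε, le_rfl⟩ _ (CuClass.monotone_nsmul y) _ hlub h.le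
  have h3 : cuCls a + cuCls a = cuCls (b + c) := by rw [cuCls_add hb hc hbc, h1, h2]
  rw [h3, cuCls_le_iff (add_nonneg hb hc) ha]
  refine cuntzBelow_of_forall_near fun ε hε => ⟨cut (ε / 2) b + cut (ε / 2) c, ?_, ?_⟩
  · rw [add_sub_add_comm]
    refine (norm_add_le _ _).trans ?_
    linarith [norm_sub_cut_le hb (half_pos hε).le, norm_sub_cut_le hc (half_pos hε).le]
  · obtain ⟨n, hn⟩ := key hb h1 _ (half_pos hε)
    obtain ⟨m, hm⟩ := key hc h2 _ (half_pos hε)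
    rw [← cuCls_le_iff (add_nonneg (cut_nonneg _ _) (cut_nonneg _ _)) ha]
    refine (cuCls_add_le (cut_nonneg _ _) (cut_nonneg _ _)).trans
      ((CuClass.add_mono hn hm).trans ?_)
    rw [← add_nsmul]
    exact hlub.1 ⟨n + m, rfl⟩

/-- The Cuntz classes of a separable stable C*-algebra form a `Cu`-semigroup. -/
noncomputable instance [TopologicalSpace.SeparableSpace D] : CuSemigroup (CuClass D) where
  add_le_add' _ _ h _ := CuClass.add_mono le_rfl h
  zero_le' := CuClass.zero_le
  exists_isLUB _ hf := let ⟨a, _, h, _⟩ := exists_isLUB_cuCls hf; ⟨cuCls a, h⟩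
  exists_waybelow_seq := CuClass.exists_waybelow_seq'
  waybelow_add := CuClass.waybelow_add'
  almost_algebraic _ _ _ _ _ := CuClass.almost_algebraic'
  almost_riesz _ _ _ _ := CuClass.almost_riesz'
  infty y := (CuClass.exists_infty y).choose
  isLUB_infty y := (CuClass.exists_infty y).choose_spec.1
  meetInfty x y := (CuClass.exists_isGLB x _ (CuClass.exists_infty y).choose_spec.2).choose
  isGLB_meetInfty x y := (CuClass.exists_isGLB x _ (CuClass.exists_infty y).choose_spec.2).choose_spec

end CuClass

section Shifts

variable {D : Type*} [NonUnitalCStarAlgebra D]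

theorem norm_sub_eq_of_star_mul {x x' y y' : D} (h₁ : star y * y = star x * x)
    (h₂ : star y * y' = star x * x') (h₃ : star y' * y = star x' * x)
    (h₄ : star y' * y' = star x' * x') : ‖y - y'‖ = ‖x - x'‖ := by
  have h : star (y - y') * (y - y') = star (x - x') * (x - x') := by
    simp only [star_sub, sub_mul, mul_sub, h₁, h₂, h₃, h₄]
  have h5 := CStarRing.norm_star_mul_self (x := y - y')
  rw [h, CStarRing.norm_star_mul_self] at h5
  exact ((mul_self_inj (norm_nonneg _) (norm_nonneg _)).1 h5).symm

theorem exists_isShiftSystem_of_dense {U : Set D} (hU : Dense U) (S : ℕ → U → D)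
    (hS : ∀ i j x y, star (S i x) * S j y = if i = j then star (x : D) * y else 0) :
    ∃ L : ℕ → D → D, IsShiftSystem L := by
  have happ : ∀ x : D, ∃ u : ℕ → U, Tendsto (fun n => (u n : D)) atTop (𝓝 x) := fun x => by
    obtain ⟨u, hu, hux⟩ := mem_closure_iff_seq_limit.1 (hU x)
    exact ⟨fun n => ⟨u n, hu n⟩, hux⟩
  choose u hu using happ
  have hlim : ∀ i x, ∃ y, Tendsto (fun n => S i (u x n)) atTop (𝓝 y) := fun i x => by
    refine cauchySeq_tendsto_of_complete ?_
    have hdist : ∀ n m, dist (S i (u x n)) (S i (u x m)) = dist (u x n : D) (u x m) := fun n m => by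
      rw [dist_eq_norm, dist_eq_norm]
      apply norm_sub_eq_of_star_mul <;> rw [hS, if_pos rfl]
    have hc := (hu x).cauchySeq
    rw [Metric.cauchySeq_iff] at hc ⊢
    simpa only [hdist] using hc
  choose L hL using hlim
  refine ⟨L, fun i j x y => ?_⟩
  have h1 : Tendsto (fun n => star (S i (u x n)) * S j (u y n)) atTop (𝓝 (star (L i x) * L j y)) :=
    (hL i x).star.mul (hL j y)
  refine tendsto_nhds_unique h1 ?_
  simp only [hS]
  by_cases h : i = j
  · simp only [h, if_true]
    exact (hu x).star.mul (hu y)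
  · simp only [h, if_false]
    exact tendsto_const_nhds

variable {B : Type*} [NonUnitalCStarAlgebra B]

/-- The upper left `n × n` corner of an infinite matrix. -/
def corner (n : ℕ) (f : ℕ → ℕ → B) : Matrix (Fin n) (Fin n) B := Matrix.of fun i j => f i j

/-- The infinite matrix `f` is supported in the upper left `n × n` corner. -/
def SuppIn (n : ℕ) (f : ℕ → ℕ → B) : Prop := ∀ i j, n ≤ i ∨ n ≤ j → f i j = 0

theorem SuppIn.mono {n m : ℕ} {f : ℕ → ℕ → B} (h : SuppIn n f) (hnm : n ≤ m) : SuppIn m f :=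
  fun i j hij => h i j (hij.imp hnm.trans hnm.trans)

theorem matPad_corner {n : ℕ} {f : ℕ → ℕ → B} (h : SuppIn n f) :
    matPad (corner n f) = corner (n + 1) f := by
  ext i j
  simp only [matPad, corner, Matrix.of_apply]
  split_ifs with hij
  · rfl
  · rw [h]
    omega

/-- Moving row `r` of an infinite matrix to row `Nat.pair k r`. -/
def rowShift (k : ℕ) (f : ℕ → ℕ → B) : ℕ → ℕ → B :=
  fun r c => if r.unpair.1 = k then f r.unpair.2 c else 0

theorem rowShift_pair (k r c : ℕ) (f : ℕ → ℕ → B) : rowShift k f (Nat.pair k r) c = f r c := by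
  simp [rowShift]

theorem SuppIn.rowShift {n : ℕ} {f : ℕ → ℕ → B} (h : SuppIn n f) (k : ℕ) :
    SuppIn (max n (Nat.pair k n)) (rowShift k f) := by
  intro r c hrc
  unfold CuntzComparison.rowShift
  split_ifs with hr
  · refine h _ _ ?_
    rcases hrc with hrc | hrc
    · left
      by_contra! hlt
      have h1 : Nat.pair k n ≤ r := (le_max_right _ _).trans hrc
      rw [← Nat.pair_unpair r, hr] at h1
      exact absurd (Nat.pair_lt_pair_right k hlt) (not_lt.2 h1)
    · exact Or.inr ((le_max_left _ _).trans hrc)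
  · rfl

theorem star_corner_mul_corner {n : ℕ} (f g : ℕ → ℕ → B) (i j : Fin n) :
    (star (corner n f) * corner n g) i j = ∑ r ∈ Finset.range n, star (f r i) * g r j := by
  rw [Matrix.mul_apply, Finset.sum_range]
  rfl

theorem star_corner_rowShift_mul {n : ℕ} {f g : ℕ → ℕ → B} {k l : ℕ}
    (hfn : SuppIn n f) (hf : SuppIn n (rowShift k f)) :
    star (corner n (rowShift k f)) * corner n (rowShift l g) =
      if k = l then star (corner n f) * corner n g else 0 := by
  ext i j
  split_ifs with h
  · subst h
    rw [star_corner_mul_corner, star_corner_mul_corner]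
    symm
    have hne : ∀ r, star (f r i) * g r j ≠ 0 → Nat.pair k r < n := fun r hr => by
      by_contra! hle
      refine hr ?_
      rw [← rowShift_pair k r i f, hf _ _ (Or.inl hle), star_zero, zero_mul]
    refine Finset.sum_bij_ne_zero (fun r _ _ => Nat.pair k r)
      (fun r _ hr => Finset.mem_range.2 (hne r hr)) ?_ ?_ ?_
    · intro a _ _ b _ _ hab
      exact (Nat.pair_eq_pair.1 hab).2
    · intro r _ hr
      have hk : r.unpair.1 = k := by
        by_contra hk
        exact hr (by simp [rowShift, hk])
      have hr' : Nat.pair k r.unpair.2 = r := by rw [← hk, Nat.pair_unpair]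
      rw [← hr', rowShift_pair, rowShift_pair] at hr
      refine ⟨r.unpair.2, Finset.mem_range.2 ?_, hr, hr'⟩
      by_contra! hle
      exact hr (by rw [hfn _ _ (Or.inl hle), star_zero, zero_mul])
    · intro r _ _
      rw [rowShift_pair, rowShift_pair]
  · rw [star_corner_mul_corner]
    refine Finset.sum_eq_zero fun r _ => ?_
    unfold rowShift
    split_ifs with h1 h2
    · exact absurd (h1.symm.trans h2) h
    all_goals simp

theorem exists_isShiftSystem_of_matEmb
    (matEmb : (n : ℕ) → (Matrix (Fin n) (Fin n) B →⋆ₙₐ[ℂ] D))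
    (hcompat : ∀ (n : ℕ) (a : Matrix (Fin n) (Fin n) B), matEmb (n + 1) (matPad a) = matEmb n a)
    (hdense : Dense (⋃ n, Set.range (matEmb n))) : ∃ L : ℕ → D → D, IsShiftSystem L := by
  have hmono : ∀ {n m : ℕ} {f : ℕ → ℕ → B}, SuppIn n f → n ≤ m →
      matEmb m (corner m f) = matEmb n (corner n f) := by
    intro n m f hf hnm
    induction m, hnm using Nat.le_induction with
    | base => rfl
    | succ m hm ih => rw [← matPad_corner (hf.mono hm), hcompat, ih]
  have hex : ∀ (k : ℕ) (x : ⋃ n, Set.range (matEmb n)), ∃ (y : D) (n : ℕ) (f : ℕ → ℕ → B),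
      SuppIn n f ∧ SuppIn n (rowShift k f) ∧ (x : D) = matEmb n (corner n f) ∧
        y = matEmb n (corner n (rowShift k f)) := by
    rintro k ⟨x, hx⟩
    obtain ⟨n, M, rfl⟩ := Set.mem_iUnion.1 hx
    set f : ℕ → ℕ → B := fun i j => if h : i < n ∧ j < n then M ⟨i, h.1⟩ ⟨j, h.2⟩ else 0 with hf
    have hfs : SuppIn n f := fun i j hij => dif_neg (by omega)
    have hM : M = corner n f := by
      ext i j
      simp [corner, hf]
    exact ⟨_, max n (Nat.pair k n), f, hfs.mono (le_max_left _ _), hfs.rowShift k,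
      by rw [hmono hfs (le_max_left _ _), ← hM], rfl⟩
  choose S n f h1 h2 h3 h4 using hex
  refine exists_isShiftSystem_of_dense hdense S fun i j x y => ?_
  rw [h4, h4, h3 i x, h3 j y, ← hmono (h1 i x) (le_max_left _ (n j y)),
    ← hmono (h2 i x) (le_max_left _ (n j y)), ← hmono (h1 j y) (le_max_right (n i x) _),
    ← hmono (h2 j y) (le_max_right (n i x) _), ← map_star, ← map_mul,
    star_corner_rowShift_mul ((h1 i x).mono (le_max_left _ _)) ((h2 i x).mono (le_max_left _ _)),
    ← map_star, ← map_mul]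
  split_ifs
  · rfl
  · exact map_zero _

end Shifts

section Model

variable {B : Type} [NonUnitalCStarAlgebra B]
  {D : Type} [NonUnitalCStarAlgebra D] [PartialOrder D] [StarOrderedRing D] [HasShifts D]
  [TopologicalSpace.SeparableSpace D]

/-- The Cuntz classes of a separable stabilization of `B` form a Cuntz semigroup of `B`. -/
noncomputable def isCuntzSemigroupOfCuClass
    (matEmb : (n : ℕ) → (Matrix (Fin n) (Fin n) B →⋆ₙₐ[ℂ] D))
    (hinj : ∀ n, Function.Injective (matEmb n))
    (hcompat : ∀ (n : ℕ) (a : Matrix (Fin n) (Fin n) B), matEmb (n + 1) (matPad a) = matEmb n a)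
    (hdense : Dense (⋃ n, Set.range (matEmb n))) : IsCuntzSemigroupOf B (CuClass D) where
  stab := D
  matEmb := matEmb
  matEmb_injective := hinj
  matEmb_compat := hcompat
  matEmb_dense := hdense
  cls := cuCls
  cls_zero := rfl
  cls_surj s := let ⟨a, ha, h⟩ := exists_cuCls s; ⟨a, cStarNonneg_iff.2 ha, h⟩
  cls_le_iff _ _ ha hb := cuCls_le_iff (cStarNonneg_iff.1 ha) (cStarNonneg_iff.1 hb)
  cls_add_orth _ _ ha hb h := cuCls_add (cStarNonneg_iff.1 ha) (cStarNonneg_iff.1 hb) h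
  exists_orth a b _ _ :=
    let ⟨a', b', ha, hb, h, h₁, h₂⟩ := exists_orth_pair (cuCls a) (cuCls b)
    ⟨a', b', cStarNonneg_iff.2 ha, cStarNonneg_iff.2 hb, h, h₁, h₂⟩
  waybelow_iff _ _ ha := wayBelow_cuCls_iff (cStarNonneg_iff.1 ha)

end Model

section Pullback

open scoped CStarAlgebra in
theorem continuous_nonUnitalStarAlgHom {D E : Type*} [NonUnitalCStarAlgebra D]
    [NonUnitalCStarAlgebra E] (φ : D →⋆ₙₐ[ℂ] E) : Continuous φ :=
  map_continuous φ

theorem _root_.CuntzBelow.map {D E : Type*} [NonUnitalCStarAlgebra D]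
    [NonUnitalCStarAlgebra E] (φ : D →⋆ₙₐ[ℂ] E) {a b : D} (h : CuntzBelow a b) :
    CuntzBelow (φ a) (φ b) := by
  obtain ⟨r, hr⟩ := h
  refine ⟨fun n => φ (r n), ?_⟩
  simpa [Function.comp_def, map_star] using ((continuous_nonUnitalStarAlgHom φ).tendsto a).comp hr

variable {A : Type} [NonUnitalCStarAlgebra A] {S : Type} [CuSemigroup S]
  (hS : IsCuntzSemigroupOf A S) {D : Type} [NonUnitalCStarAlgebra D] [PartialOrder D]
  [StarOrderedRing D] (φ : D →⋆ₙₐ[ℂ] hS.stab)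

theorem cStarNonneg_map {E : Type*} [NonUnitalCStarAlgebra E] (φ : D →⋆ₙₐ[ℂ] E) {a : D}
    (ha : 0 ≤ a) : CStarNonneg (φ a) := by
  obtain ⟨b, rfl⟩ := cStarNonneg_iff.2 ha
  exact ⟨φ b, by rw [map_mul, map_star]⟩

/-- The map of Cuntz semigroups induced by a `*`-homomorphism into the stabilization. -/
noncomputable def cuMap (x : CuClass D) : S := hS.cls (φ (rep x))

theorem cuMap_mono {x y : CuClass D} (h : x ≤ y) : cuMap hS φ x ≤ cuMap hS φ y := by
  rw [← cuCls_rep x, ← cuCls_rep y, cuCls_le_iff (rep_nonneg x) (rep_nonneg y)] at h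
  exact (hS.cls_le_iff _ _ (cStarNonneg_map φ (rep_nonneg x))
    (cStarNonneg_map φ (rep_nonneg y))).2 (h.map φ)

theorem cuMap_cuCls {a : D} (ha : 0 ≤ a) : cuMap hS φ (cuCls a) = hS.cls (φ a) := by
  have hr := rep_nonneg (cuCls a)
  have h := cuCls_rep (cuCls a)
  have h₁ := ((cuCls_le_iff hr ha).1 h.le).map φ
  have h₂ := ((cuCls_le_iff ha hr).1 h.ge).map φ
  exact le_antisymm ((hS.cls_le_iff _ _ (cStarNonneg_map φ hr) (cStarNonneg_map φ ha)).2 h₁)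
    ((hS.cls_le_iff _ _ (cStarNonneg_map φ ha) (cStarNonneg_map φ hr)).2 h₂)

theorem cuMap_zero : cuMap hS φ 0 = 0 := by
  rw [show (0 : CuClass D) = cuCls 0 from rfl, cuMap_cuCls hS φ le_rfl, map_zero, hS.cls_zero]

theorem cuMap_add [HasShifts D] (x y : CuClass D) :
    cuMap hS φ (x + y) = cuMap hS φ x + cuMap hS φ y := by
  obtain ⟨a, b, ha, hb, h, rfl, rfl⟩ := exists_orth_pair x y
  rw [← cuCls_add ha hb h, cuMap_cuCls hS φ (add_nonneg ha hb), cuMap_cuCls hS φ ha,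
    cuMap_cuCls hS φ hb, map_add, hS.cls_add_orth _ _ (cStarNonneg_map φ ha)
      (cStarNonneg_map φ hb) (by rw [← map_mul, h, map_zero])]

theorem map_cut {a : D} (ha : 0 ≤ a) {ε : ℝ} (hε : 0 ≤ ε) {E : Type*} [NonUnitalCStarAlgebra E]
    (φ : D →⋆ₙₐ[ℂ] E) : φ (cut ε a) = cfcₙ (fun t : ℝ => max (t - ε) 0) (φ a) :=
  φ.map_cfcₙ (R := ℝ) _ a (continuous_max_sub ε).continuousOn (max_zero_sub hε)
    (continuous_nonUnitalStarAlgHom φ) ha.isSelfAdjoint (ha.isSelfAdjoint.map φ)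

theorem functional_cls_le (lam : CuFunctional S) {a : hS.stab} (ha : CStarNonneg a) {t : ℝ≥0∞}
    (h : ∀ ε : ℝ, 0 < ε → lam (hS.cls (cfcₙ (fun t : ℝ => max (t - ε) 0) a)) ≤ t) :
    lam (hS.cls a) ≤ t := by
  obtain ⟨f, hf, hff, hsup⟩ := CuSemigroup.exists_waybelow_seq (hS.cls a)
  rw [lam.sup' f hf _ hsup]
  refine iSup_le fun n => ?_
  have hn : WayBelow (f n) (hS.cls a) :=
    (hff n).mono le_rfl (hsup.1 ⟨n + 1, rfl⟩)
  obtain ⟨ε, hε, hle⟩ := (hS.waybelow_iff _ _ ha).1 hn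
  exact (lam.mono' _ _ hle).trans (h ε hε)

/-- Pulling back functionals along the map induced by a `*`-homomorphism. -/
noncomputable def pullback [HasShifts D] [TopologicalSpace.SeparableSpace D]
    (lam : CuFunctional S) : CuFunctional (CuClass D) where
  toFun x := lam (cuMap hS φ x)
  map_zero' := (congrArg lam.toFun (cuMap_zero hS φ)).trans lam.map_zero'
  map_add' x y := (congrArg lam.toFun (cuMap_add hS φ x y)).trans (lam.map_add' _ _)
  mono' _ _ h := lam.mono' _ _ (cuMap_mono hS φ h)
  sup' f hf s hs := by
    refine le_antisymm ?_ (iSup_le fun n => lam.mono' _ _ (cuMap_mono hS φ (hs.1 ⟨n, rfl⟩)))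
    obtain ⟨a, ha, rfl⟩ := exists_cuCls s
    rw [cuMap_cuCls hS φ ha]
    refine functional_cls_le hS lam (cStarNonneg_map φ ha) fun ε hε => ?_
    obtain ⟨n, hn⟩ := (wayBelow_cuCls_iff ha).2 ⟨ε, hε, le_rfl⟩ f hf _ hs le_rfl
    rw [← map_cut ha hε.le, ← cuMap_cuCls hS φ (cut_nonneg ε a)]
    exact le_iSup_of_le n (lam.mono' _ _ (cuMap_mono hS φ hn))

theorem isLscAffine_const_mul {T : Type*} [CuSemigroup T] (x : T) {r : ℝ≥0∞} (hr : r ≠ ∞) :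
    CuDiv.IsLscAffine fun lam : CuFunctional T => r * lam x := by
  refine ⟨?_, fun lam mu nu h => ?_, fun s lam nu h => ?_⟩
  · let := CuDiv.functionalTopology T
    have hx : LowerSemicontinuous fun lam : CuFunctional T => lam x :=
      lowerSemicontinuous_iff_isOpen_preimage.2 fun s =>
        TopologicalSpace.isOpen_generateFrom_of_mem (Or.inl ⟨x, s, rfl⟩)
    exact (ENNReal.continuous_const_mul hr).comp_lowerSemicontinuous hx
      fun _ _ h => mul_le_mul_right h r
  · simp only [h, mul_add]
  · simp only [h, mul_left_comm]

/-- If `x` comes from a separable stabilization of an algebra with surjective rank map, then any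
finite multiple of its rank is realized in the big algebra. -/
theorem exists_functional_eq_const_mul [HasShifts D] [TopologicalSpace.SeparableSpace D]
    (hD : CuDiv.SurjectiveRankMap (CuClass D)) {a : D} (ha : 0 ≤ a) {r : ℝ≥0∞} (hr : r ≠ ∞) :
    ∃ y : S, ∀ lam : CuFunctional S, lam y = r * lam (hS.cls (φ a)) := by
  obtain ⟨y, hy⟩ := hD _ (isLscAffine_const_mul (cuCls a) hr)
  refine ⟨cuMap hS φ y, fun lam => ?_⟩
  rw [← cuMap_cuCls hS φ ha]
  exact hy (pullback hS φ lam)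

end Pullback

section Separable

open CStarAlgebra in
theorem continuous_matrix_starAlgHom {B D : Type*} [NonUnitalCStarAlgebra B]
    [NonUnitalCStarAlgebra D] {n : ℕ} (φ : Matrix (Fin n) (Fin n) B →⋆ₙₐ[ℂ] D) : Continuous φ := by
  let := spectralOrder B
  have := spectralOrderedRing B
  let ψ : CStarMatrix (Fin n) (Fin n) B →⋆ₙₐ[ℂ] D :=
    { toFun := fun M => φ (CStarMatrix.ofMatrix.symm M)
      map_smul' := fun c M => map_smul φ c (CStarMatrix.ofMatrix.symm M)
      map_zero' := map_zero φ
      map_add' := fun M N => map_add φ (CStarMatrix.ofMatrix.symm M) (CStarMatrix.ofMatrix.symm N)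
      map_mul' := fun M N => map_mul φ (CStarMatrix.ofMatrix.symm M) (CStarMatrix.ofMatrix.symm N)
      map_star' := fun M => map_star φ (CStarMatrix.ofMatrix.symm M) }
  exact continuous_nonUnitalStarAlgHom ψ

theorem isSeparable_range_matrix_starAlgHom {B D : Type*} [NonUnitalCStarAlgebra B]
    [TopologicalSpace.SeparableSpace B] [NonUnitalCStarAlgebra D] {n : ℕ}
    (φ : Matrix (Fin n) (Fin n) B →⋆ₙₐ[ℂ] D) : TopologicalSpace.IsSeparable (Set.range φ) := by
  have : TopologicalSpace.SeparableSpace (Matrix (Fin n) (Fin n) B) :=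
    inferInstanceAs (TopologicalSpace.SeparableSpace (Fin n → Fin n → B))
  exact TopologicalSpace.isSeparable_range (continuous_matrix_starAlgHom φ)

theorem separableSpace_topologicalClosure {D : Type*} [NonUnitalCStarAlgebra D]
    {U : NonUnitalStarSubalgebra ℂ D} (hU : TopologicalSpace.IsSeparable (U : Set D)) :
    TopologicalSpace.SeparableSpace U.topologicalClosure :=
  hU.closure.separableSpace

theorem countable_subsemigroup_closure {M : Type*} [Semigroup M] {s : Set M} (hs : s.Countable) :
    (Subsemigroup.closure s : Set M).Countable := by
  have := hs.to_subtype
  have hle : Subsemigroup.closure s ≤ (FreeSemigroup.lift ((↑) : s → M)).srange :=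
    Subsemigroup.closure_le.2 fun x hx => ⟨FreeSemigroup.of ⟨x, hx⟩, by simp⟩
  have : Countable (FreeSemigroup s) :=
    Function.Injective.countable (f := fun w : FreeSemigroup s => (w.head, w.tail))
      fun v w h => FreeSemigroup.ext (congrArg Prod.fst h) (congrArg Prod.snd h)
  exact (Set.countable_range (FreeSemigroup.lift ((↑) : s → M))).mono hle

theorem isSeparable_adjoin {A : Type*} [NonUnitalCStarAlgebra A] {s : Set A} (hs : s.Countable) :
    TopologicalSpace.IsSeparable (NonUnitalStarAlgebra.adjoin ℂ s : Set A) := by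
  have h : (s ∪ star s).Countable := hs.union (hs.preimage star_injective)
  have := (countable_subsemigroup_closure h).isSeparable.span (R := ℂ)
  rwa [← NonUnitalStarAlgebra.adjoin_eq_span] at this

end Separable

section Subalgebra

/-- The entrywise inclusion of matrices over a subalgebra. -/
def matIncl {A : Type*} [NonUnitalCStarAlgebra A] (B : NonUnitalStarSubalgebra ℂ A) (n : ℕ) :
    Matrix (Fin n) (Fin n) B →⋆ₙₐ[ℂ] Matrix (Fin n) (Fin n) A where
  toFun M := M.map (↑)
  map_smul' _ _ := rfl
  map_zero' := rfl
  map_add' _ _ := rfl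
  map_mul' M N := by
    ext i j
    simp [Matrix.mul_apply]
  map_star' _ := rfl

theorem matIncl_injective {A : Type*} [NonUnitalCStarAlgebra A] (B : NonUnitalStarSubalgebra ℂ A)
    (n : ℕ) : Function.Injective (matIncl B n) :=
  Matrix.map_injective Subtype.val_injective

theorem matIncl_matPad {A : Type*} [NonUnitalCStarAlgebra A] (B : NonUnitalStarSubalgebra ℂ A)
    {n : ℕ} (M : Matrix (Fin n) (Fin n) B) :
    matIncl B (n + 1) (matPad M) = matPad (matIncl B n M) := by
  ext i j
  change ((matPad M i j : B) : A) = matPad (matIncl B n M) i j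
  simp only [matPad, Matrix.of_apply]
  split_ifs <;> rfl

variable {A : Type} [NonUnitalCStarAlgebra A] {S : Type} [CuSemigroup S]
  (hS : IsCuntzSemigroupOf A S)

theorem exists_countable_mem_closure (c : hS.stab) : ∃ s : Set A, s.Countable ∧
    c ∈ closure (⋃ n, hS.matEmb n '' {M | ∀ i j, M i j ∈ s}) := by
  obtain ⟨x, hx, hlim⟩ := mem_closure_iff_seq_limit.1 (hS.matEmb_dense c)
  choose n M hM using fun k => Set.mem_iUnion.1 (hx k)
  refine ⟨⋃ k, Set.range fun p : Fin (n k) × Fin (n k) => M k p.1 p.2,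
    Set.countable_iUnion fun k => Set.countable_range _,
    mem_closure_of_tendsto hlim (Eventually.of_forall fun k => ?_)⟩
  exact Set.mem_iUnion.2 ⟨n k, M k, fun i j => Set.mem_iUnion.2 ⟨k, (i, j), rfl⟩, hM k⟩

open CStarAlgebra in
theorem exists_functional_eq_const_mul_of_subalgebra (B : NonUnitalStarSubalgebra ℂ A)
    [IsClosed (B : Set A)] [TopologicalSpace.SeparableSpace B] (hB : HasSurjectiveRankMap B)
    {c : hS.stab} (hc : c ∈ closure (⋃ n, hS.matEmb n '' {M | ∀ i j, M i j ∈ B}))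
    {r : ℝ≥0∞} (hr : r ≠ ∞) :
    ∃ y : S, ∀ lam : CuFunctional S, lam y = r * lam (hS.cls (star c * c)) := by
  let f : (n : ℕ) → (Matrix (Fin n) (Fin n) B →⋆ₙₐ[ℂ] hS.stab) :=
    fun n => (hS.matEmb n).comp (matIncl B n)
  have hcompat : ∀ (n : ℕ) (M : Matrix (Fin n) (Fin n) B), f (n + 1) (matPad M) = f n M :=
    fun n M => (congrArg (hS.matEmb (n + 1)) (matIncl_matPad B M)).trans (hS.matEmb_compat n _)
  have hmono : Monotone fun n => NonUnitalStarAlgHom.range (f n) := by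
    refine monotone_nat_of_le_succ fun n => ?_
    rintro _ ⟨M, rfl⟩
    exact ⟨matPad M, hcompat n M⟩
  have hU := NonUnitalStarSubalgebra.coe_iSup_of_directed hmono.directed_le
  set U : NonUnitalStarSubalgebra ℂ hS.stab := ⨆ n, NonUnitalStarAlgHom.range (f n)
  replace hU : (U : Set hS.stab) = ⋃ n, Set.range (f n) := hU
  have hsep : TopologicalSpace.SeparableSpace U.topologicalClosure := by
    refine separableSpace_topologicalClosure ?_
    rw [hU]
    exact .iUnion fun n => isSeparable_range_matrix_starAlgHom (f n)
  have hclosed : IsClosed (U.topologicalClosure : Set hS.stab) := U.isClosed_topologicalClosure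
  have hmem : ∀ n M, f n M ∈ U.topologicalClosure := fun n M =>
    U.le_topologicalClosure ((Set.ext_iff.1 hU _).2 (Set.mem_iUnion.2 ⟨n, M, rfl⟩))
  let g : (n : ℕ) → (Matrix (Fin n) (Fin n) B →⋆ₙₐ[ℂ] U.topologicalClosure) :=
    fun n => NonUnitalStarAlgHom.codRestrict (f n) _ (hmem n)
  have hginj : ∀ n, Function.Injective (g n) := fun n M N h =>
    matIncl_injective B n (hS.matEmb_injective n (congrArg Subtype.val h))
  have hgcompat : ∀ (n : ℕ) (M : Matrix (Fin n) (Fin n) B), g (n + 1) (matPad M) = g n M :=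
    fun n M => Subtype.ext (hcompat n M)
  have hgdense : Dense (⋃ n, Set.range (g n)) := by
    intro x
    rw [closure_subtype]
    have hx : (x : hS.stab) ∈ closure (U : Set hS.stab) := x.2
    rw [hU] at hx
    refine closure_mono ?_ hx
    rintro _ ⟨_, ⟨n, rfl⟩, M, rfl⟩
    exact ⟨g n M, Set.mem_iUnion.2 ⟨n, M, rfl⟩, rfl⟩
  obtain ⟨L, hL⟩ := exists_isShiftSystem_of_matEmb g hgcompat hgdense
  let := HasShifts.mk L hL
  let := spectralOrder U.topologicalClosure
  have := spectralOrderedRing U.topologicalClosure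
  have hcU : c ∈ U.topologicalClosure := by
    change c ∈ closure (U : Set hS.stab)
    rw [hU]
    refine closure_mono (Set.iUnion_mono fun n => ?_) hc
    rintro _ ⟨M, hM, rfl⟩
    exact ⟨Matrix.of fun i j => ⟨M i j, hM i j⟩, rfl⟩
  exact exists_functional_eq_const_mul hS
    (NonUnitalStarSubalgebraClass.subtype U.topologicalClosure)
    (hB _ _ (isCuntzSemigroupOfCuClass g hginj hgcompat hgdense))
    (star_mul_self_nonneg (⟨c, hcU⟩ : U.topologicalClosure)) hr

end Subalgebra

theorem exists_functional_eq_const_mul_of_cofinal {A : Type}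
    [NonUnitalCStarAlgebra A] {S : Type} [CuSemigroup S] (hS : IsCuntzSemigroupOf A S)
    (hfam : SepSurjRankFamilySigmaCompleteCofinal A) (x : S) {r : ℝ≥0∞} (hr : r ≠ ∞) :
    ∃ y : S, ∀ lam : CuFunctional S, lam y = r * lam x := by
  obtain ⟨_, ⟨c, rfl⟩, rfl⟩ := hS.cls_surj x
  obtain ⟨s, hs, hc⟩ := exists_countable_mem_closure hS c
  obtain ⟨B, ⟨hclosed, hsep, hB⟩, hle⟩ := hfam.2 (NonUnitalStarAlgebra.adjoin ℂ s).topologicalClosure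
    (NonUnitalStarSubalgebra.isClosed_topologicalClosure _)
    (separableSpace_topologicalClosure (isSeparable_adjoin hs))
  refine exists_functional_eq_const_mul_of_subalgebra hS B hB (closure_mono ?_ hc) hr
  refine Set.iUnion_mono fun n => Set.image_mono ?_
  intro M hM i j
  exact hle (NonUnitalStarSubalgebra.le_topologicalClosure _
    (NonUnitalStarAlgebra.subset_adjoin ℂ s (hM i j)))

section Arithmetic

variable {S : Type*} [CuSemigroup S]

theorem nsmul_mono_right (n : ℕ) {x y : S} (h : x ≤ y) : n • x ≤ n • y := by
  induction n with
  | zero => simp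
  | succ n ih =>
    rw [succ_nsmul, succ_nsmul, add_comm _ x, add_comm _ y]
    refine (CuSemigroup.add_le_add' _ _ ih x).trans ?_
    rw [add_comm x, add_comm y]
    exact CuSemigroup.add_le_add' _ _ h _

theorem functional_nsmul (lam : CuFunctional S) (n : ℕ) (x : S) : lam (n • x) = n * lam x := by
  induction n with
  | zero => simp [lam.map_zero']
  | succ n ih => rw [succ_nsmul, lam.map_add', ih, Nat.cast_succ, add_mul, one_mul]

theorem kComparison_le_nsmul {k : ℕ} (h : CuDiv.KComparison S k) {x y : S}
    (hxy : CuDiv.FunctionalLT x y) : x ≤ (k + 1) • y := by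
  simpa using h x (fun _ => y) fun _ => hxy

theorem div_le_of_le_nsmul {m n : ℕ} (hn : 1 ≤ n) {x y : S} (h₁ : m • y ≤ x) (h₂ : x ≤ n • y) :
    CuDiv.Div m x ≤ n :=
  sInf_le ⟨n, hn, rfl, fun _ hx => ⟨y, hx.le.trans h₂, h₁⟩⟩

theorem le_nsmul_of_functional_eq {k : ℕ} (h : CuDiv.KComparison S k) {x y : S}
    (hy : ∀ lam : CuFunctional S, lam y = (3 * (k + 1 : ℕ) : ℝ≥0∞)⁻¹ * lam x) :
    (2 * (k + 1)) • y ≤ (k + 1) • x ∧ (k + 1) • x ≤ (4 * (k + 1) ^ 3) • y := by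
  have hk : ((k + 1 : ℕ) : ℝ≥0∞) ≠ 0 := by simp
  have hk' : ((k + 1 : ℕ) : ℝ≥0∞) ≠ ∞ := ENNReal.natCast_ne_top _
  have hinv : ((3 : ℝ≥0∞) * (k + 1 : ℕ))⁻¹ = 3⁻¹ * ((k + 1 : ℕ) : ℝ≥0∞)⁻¹ :=
    ENNReal.mul_inv (by simp) (by simp)
  have h4 : ((4 : ℝ≥0∞)⁻¹ * 4) = 1 := ENNReal.inv_mul_cancel (by simp) (by simp)
  have h3 : ((3 : ℝ≥0∞) * 3⁻¹) = 1 := ENNReal.mul_inv_cancel (by simp) (by simp)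
  have hkk := ENNReal.mul_inv_cancel hk hk'
  constructor
  · refine kComparison_le_nsmul h ⟨2 * 3⁻¹, ?_, fun lam => ?_⟩
    · rw [← div_eq_mul_inv]
      exact ENNReal.div_lt_of_lt_mul (by norm_num)
    · rw [functional_nsmul, hy, hinv, Nat.cast_mul]
      refine le_of_eq ?_
      calc _ = (2 * 3⁻¹) * (((k + 1 : ℕ) : ℝ≥0∞) * ((k + 1 : ℕ) : ℝ≥0∞)⁻¹) * lam x := by
            push_cast; ring
        _ = _ := by rw [hkk, mul_one]
  · have hx : x ≤ (k + 1) • ((4 * (k + 1)) • y) := by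
      refine kComparison_le_nsmul h ⟨3 * 4⁻¹, ?_, fun lam => ?_⟩
      · rw [← div_eq_mul_inv]
        exact ENNReal.div_lt_of_lt_mul (by norm_num)
      · rw [functional_nsmul, hy, hinv, Nat.cast_mul]
        refine le_of_eq ?_
        calc lam x = (4⁻¹ * 4) * (3 * 3⁻¹) *
              (((k + 1 : ℕ) : ℝ≥0∞) * ((k + 1 : ℕ) : ℝ≥0∞)⁻¹) * lam x := by
              rw [hkk, h4, h3, one_mul, one_mul, one_mul]
          _ = _ := by push_cast; ring
    refine (nsmul_mono_right (k + 1) hx).trans_eq ?_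
    rw [smul_smul, smul_smul]
    congr 1
    ring

end Arithmetic

end CuntzComparison

/-- Proposition 4.4.  For a nowhere scattered C*-algebra with
`k`-comparison whose family of separable sub-C*-algebras with a surjective rank map is
σ-complete and cofinal, every `x ∈ Cu(A)` admits `y` with
`2(k+1)·y ≤ (k+1)·x ≤ 4(k+1)³·y`; in particular
`Div_{2(k+1)}((k+1)·x) ≤ 4(k+1)³`. -/
theorem div_bound_of_kComparison
    (A : Type) [NonUnitalCStarAlgebra A] (S : Type) [CuSemigroup S]
    (hS : IsCuntzSemigroupOf A S)
    (k : ℕ) (hns : NowhereScattered A) (hcomp : CuDiv.KComparison S k)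
    (hfam : SepSurjRankFamilySigmaCompleteCofinal A) :
    ∀ x : S, (∃ y : S, (2 * (k + 1)) • y ≤ (k + 1) • x ∧
        (k + 1) • x ≤ (4 * (k + 1) ^ 3) • y) ∧
      CuDiv.Div (2 * (k + 1)) ((k + 1) • x) ≤ (4 * (k + 1) ^ 3 : ℕ) := by
  intro x
  obtain ⟨y, hy⟩ := CuntzComparison.exists_functional_eq_const_mul_of_cofinal hS hfam x
    (r := (3 * (k + 1 : ℕ) : ℝ≥0∞)⁻¹) (ENNReal.inv_ne_top.2 (by simp))
  obtain ⟨h₁, h₂⟩ := CuntzComparison.le_nsmul_of_functional_eq hcomp hy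
  exact ⟨⟨y, h₁, h₂⟩,
    CuntzComparison.div_le_of_le_nsmul (Nat.mul_pos four_pos (by positivity)) h₁ h₂⟩
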